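/- arXiv:1807.04196 — 3 statements merged into one kernel-verified Lean document; each statement's English description precedes it below -/
import Mathlib

section
/- Every cubic graph admits an orientable 5-weak bisection. -/
open Finset
open scoped Classical

namespace BEF

variable {V : Type*}

/-- An orientation of a simple graph: each edge gets exactly one direction. -/
structure Orientation (G : SimpleGraph V) where
  dir : V → V → Prop
  adj_of_dir : ∀ u v, dir u v → G.Adj u v
  dir_iff_not : ∀ u v, G.Adj u v → (dir u v ↔ ¬ dir v u)

/-- Net outflow (excess) of `f` at vertex `x` in orientation `D`. -/
noncomputable def excess [Fintype V] {G : SimpleGraph V}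
    (D : Orientation G) (f : Sym2 V → ℝ) (x : V) : ℝ :=
  (∑ y : V, if D.dir x y then f s(x, y) else 0)
    - (∑ y : V, if D.dir y x then f s(x, y) else 0)

/-- `f` is an `(r, α)`-bounded-excess flow in the orientation `D` of `G`. -/
def IsBEFlow [Fintype V] {G : SimpleGraph V}
    (D : Orientation G) (r α : ℝ) (f : Sym2 V → ℝ) : Prop :=
  (∀ e ∈ G.edgeSet, 1 ≤ f e ∧ f e ≤ r - 1) ∧ ∀ x : V, |excess D f x| ≤ α

/-- `G` admits an `(r, α)`-flow. -/
def HasFlow [Fintype V] (G : SimpleGraph V) (r α : ℝ) : Prop :=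
  ∃ D : Orientation G, ∃ f : Sym2 V → ℝ, IsBEFlow D r α f

/-- Outdegree of a vertex in an orientation. -/
noncomputable def outDeg {G : SimpleGraph V} (D : Orientation G) (x : V) : ℕ :=
  {y | D.dir x y}.ncard

/-- A cubic graph: every vertex has exactly 3 neighbours. -/
def IsCubic (G : SimpleGraph V) : Prop :=
  ∀ v : V, (G.neighborSet v).ncard = 3

/-- A bisection: a partition of the vertex set into two parts of equal size. -/
def IsBisection [Fintype V] (V₁ V₂ : Set V) : Prop :=
  Disjoint V₁ V₂ ∧ V₁ ∪ V₂ = Set.univ ∧ V₁.ncard = V₂.ncard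

/-- The bisection `(V₁, V₂)` of `G` is orientable. -/
def Orientable (G : SimpleGraph V) (V₁ V₂ : Set V) : Prop :=
  ∃ D : Orientation G, (∀ v ∈ V₁, outDeg D v = 1) ∧ (∀ v ∈ V₂, outDeg D v = 2)

/-- `d(A)`: the number of edges of `G` with exactly one endvertex in `A`. -/
noncomputable def cutCard (G : SimpleGraph V) (A : Set V) : ℕ :=
  {e ∈ G.edgeSet | ∃ u ∈ A, ∃ v ∉ A, e = s(u, v)}.ncard

/-- `Δ(A) = | |V₂ ∩ A| - |V₁ ∩ A| |` (as an integer). -/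
noncomputable def disc (V₁ V₂ A : Set V) : ℤ :=
  |((V₂ ∩ A).ncard : ℤ) - ((V₁ ∩ A).ncard : ℤ)|

/-- Every connected component of the subgraph induced on `S` is a tree on
at most `k - 2` vertices. -/
def WeakSide (G : SimpleGraph V) (k : ℕ) (S : Set V) : Prop :=
  (G.induce S).IsAcyclic ∧
    ∀ c : (G.induce S).ConnectedComponent, c.supp.ncard ≤ k - 2

/-- A `k`-weak bisection. -/
def KWeak [Fintype V] (G : SimpleGraph V) (k : ℕ) (V₁ V₂ : Set V) : Prop :=
  IsBisection V₁ V₂ ∧ WeakSide G k V₁ ∧ WeakSide G k V₂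

/-- A balanced orientation: every outdegree is 1 or 2. -/
def Balanced {G : SimpleGraph V} (D : Orientation G) : Prop :=
  ∀ v : V, outDeg D v = 1 ∨ outDeg D v = 2


/-- A graph of maximum degree at most two in which no two adjacent vertices both have two
neighbours is a forest of paths on at most three vertices. -/
theorem isAcyclic_and_ncard_supp_le_three {W : Type*} {Γ : SimpleGraph W}
    (h3 : ∀ v x y z, Γ.Adj v x → Γ.Adj v y → Γ.Adj v z → x = y ∨ y = z ∨ x = z)
    (h2 : ∀ v w x y, Γ.Adj v w → Γ.Adj v x → Γ.Adj w y → x ≠ w → y ≠ v → False) :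
    Γ.IsAcyclic ∧ ∀ c : Γ.ConnectedComponent, c.supp.ncard ≤ 3 := by
  constructor
  · intro v p hp
    have two_neighbors : ∀ (w : W) (q : Γ.Walk w w), q.IsCycle → ∀ z, ∃ y, Γ.Adj w y ∧ y ≠ z := by
      intro w q hq z
      by_cases hz : q.snd = z
      · exact ⟨q.penultimate, (q.adj_penultimate hq.not_nil).symm,
          fun h => hq.snd_ne_penultimate (hz.trans h.symm)⟩
      · exact ⟨q.snd, q.adj_snd hq.not_nil, hz⟩
    have hadj := p.adj_snd hp.not_nil
    have hmem : p.snd ∈ p.support := p.getVert_mem_support 1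
    obtain ⟨x, hx, hxne⟩ := two_neighbors v p hp p.snd
    obtain ⟨y, hy, hyne⟩ := two_neighbors _ (p.rotate _ hmem) (hp.rotate hmem) v
    exact h2 _ _ x y hadj hx hy hxne hyne
  · intro c
    have key : ∀ (T : Finset W) (v : W), Γ.connectedComponentMk v = c → v ∈ T →
        (∀ a ∈ T, ∀ b, Γ.Adj a b → b ∈ T) → #T ≤ 3 → c.supp.ncard ≤ 3 := by
      intro T v hv hvT hcl hT
      have hsub : c.supp ⊆ (T : Set W) := by
        intro w hw
        have hr : Γ.Reachable v w := by
          rw [← SimpleGraph.ConnectedComponent.eq, hv]; exact hw.symm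
        obtain ⟨p⟩ := hr
        clear hw hv
        induction p with
        | nil => exact hvT
        | cons hab _ ih => exact ih (hcl _ hvT _ hab)
      calc c.supp.ncard ≤ (T : Set W).ncard := Set.ncard_le_ncard hsub T.finite_toSet
        _ ≤ 3 := by rwa [Set.ncard_coe_finset]
    by_cases htwo : ∃ v x y, Γ.connectedComponentMk v = c ∧ Γ.Adj v x ∧ Γ.Adj v y ∧ x ≠ y
    · obtain ⟨v, x, y, hv, hx, hy, hxy⟩ := htwo
      refine key {v, x, y} v hv (by simp) ?_ Finset.card_le_three
      have hx' := h2 v x y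
      have hy' := h2 v y x
      have hv' := h3 v x y
      simp only [Finset.mem_insert, Finset.mem_singleton]
      rintro a (rfl | rfl | rfl) b hab <;> grind
    · obtain ⟨v, hv⟩ := c.exists_rep
      push Not at htwo
      by_cases hx : ∃ x, Γ.Adj v x
      · obtain ⟨x, hx⟩ := hx
        have hxc : Γ.connectedComponentMk x = c := by
          rw [← hv]; exact (SimpleGraph.ConnectedComponent.sound hx.reachable).symm
        refine key {v, x} v hv (by simp) ?_ (Finset.card_le_two.trans (by norm_num))
        simp only [Finset.mem_insert, Finset.mem_singleton]
        rintro a (rfl | rfl) b hab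
        · exact Or.inr (htwo _ _ _ hv hab hx)
        · exact Or.inl (htwo _ _ _ hxc hab hx.symm)
      · refine key {v} v hv (by simp) ?_ (by simp)
        simp only [Finset.mem_singleton]
        rintro a rfl b hab
        exact absurd ⟨b, hab⟩ hx

/-- A fixed-point-free involution of a type admits a Boolean colouring that it flips. -/
theorem exists_bool_coloring_of_involutive {Q : Type*} (s : Q → Q) (hs : ∀ q, s (s q) = q)
    (hne : ∀ q, s q ≠ q) : ∃ c : Q → Bool, ∀ q, c (s q) = !c q := by
  let := linearOrderOfSTO (WellOrderingRel (α := Q))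
  refine ⟨fun q => decide (q < s q), fun q => ?_⟩
  have := hne q
  simp only [hs]
  rcases lt_trichotomy q (s q) with h | h | h
  · simp [h, h.le]
  · exact absurd h.symm this
  · simp [h, h.le]

/-- Two fixed-point-free involutions admit a common Boolean colouring flipped by both. -/
theorem exists_bool_coloring_of_two_involutive {D : Type*} (ρ τ : D → D)
    (hρ : ∀ d, ρ (ρ d) = d) (hτ : ∀ d, τ (τ d) = d)
    (hρne : ∀ d, ρ d ≠ d) (hτne : ∀ d, τ d ≠ d) :
    ∃ c : D → Bool, (∀ d, c (ρ d) = !c d) ∧ ∀ d, c (τ d) = !c d := by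
  let r : Equiv.Perm D := Function.Involutive.toPerm ρ hρ
  let t : Equiv.Perm D := Function.Involutive.toPerm τ hτ
  have hrr : r * r = 1 := Equiv.ext hρ
  have htt : t * t = 1 := Equiv.ext hτ
  let π : Equiv.Perm D := t * r
  have hconj : ∀ (n : ℤ) d, ρ ((π ^ n) d) = (π ^ (-n)) (ρ d) := by
    intro n d
    have h1 : r * π * r⁻¹ = π⁻¹ := by
      rw [eq_inv_iff_mul_eq_one, inv_eq_of_mul_eq_one_left hrr]
      calc r * (t * r) * r * (t * r) = r * t * (r * r) * t * r := by group
        _ = r * (t * t) * r := by rw [hrr]; group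
        _ = 1 := by rw [htt, mul_one, hrr]
    have h2 : r * π ^ n * r⁻¹ = π ^ (-n) := by
      rw [← conj_zpow, h1, inv_zpow, zpow_neg]
    have h3 : r * π ^ n = π ^ (-n) * r := by rw [← h2]; group
    exact congrArg (fun e : Equiv.Perm D => e d) h3
  have hfree : ∀ d, ¬ π.SameCycle d (ρ d) := by
    rintro d ⟨n, hn⟩
    obtain ⟨j, rfl | rfl⟩ := Int.even_or_odd' n
    · apply hρne ((π ^ j) d)
      rw [hconj, ← hn, ← Equiv.Perm.mul_apply, ← zpow_add]
      congr 2; ring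
    · apply hτne (ρ ((π ^ j) d))
      change π ((π ^ j) d) = _
      rw [hconj, ← hn, ← Equiv.Perm.mul_apply, ← Equiv.Perm.mul_apply, ← zpow_add,
        ← zpow_one_add]
      congr 2; ring
  let S := Equiv.Perm.SameCycle.setoid π
  have hlift : ∀ a b : D, π.SameCycle a b → π.SameCycle (ρ a) (ρ b) := by
    rintro a b ⟨n, rfl⟩
    exact ⟨-n, (hconj n a).symm⟩
  obtain ⟨c, hc⟩ := exists_bool_coloring_of_involutive (Q := Quotient S)
    (Quotient.map ρ hlift)
    (fun q => by
      induction q using Quotient.inductionOn with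
      | h d => simp [Quotient.map_mk, hρ])
    (fun q => by
      induction q using Quotient.inductionOn with
      | h d =>
        rw [Quotient.map_mk]
        exact fun h => hfree d (Quotient.exact h).symm)
  have hcρ : ∀ d, c ⟦ρ d⟧ = !c ⟦d⟧ := fun d => hc ⟦d⟧
  refine ⟨fun d => c ⟦d⟧, hcρ, fun d => ?_⟩
  rw [← hcρ]
  refine congrArg c (Quotient.sound ?_)
  refine Equiv.Perm.SameCycle.symm ⟨1, ?_⟩
  change τ (ρ (ρ d)) = τ d
  rw [hρ]

/-- A fixed-point-free involution `ρ` and an arbitrary involution `τ` admit a common Boolean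
colouring flipped by `ρ` everywhere and by `τ` away from its fixed points. -/
theorem exists_bool_coloring_of_involutive_of_free {D : Type*} (ρ τ : D → D)
    (hρ : ∀ d, ρ (ρ d) = d) (hτ : ∀ d, τ (τ d) = d) (hρne : ∀ d, ρ d ≠ d) :
    ∃ c : D → Bool, (∀ d, c (ρ d) = !c d) ∧ ∀ d, τ d ≠ d → c (τ d) = !c d := by
  obtain ⟨c, hcρ, hcτ⟩ := exists_bool_coloring_of_two_involutive (D := D × Bool)
    (fun p => (ρ p.1, p.2)) (fun p => if τ p.1 = p.1 then (p.1, !p.2) else (τ p.1, p.2))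
    (fun p => by simp [hρ])
    (fun p => by
      by_cases h : τ p.1 = p.1
      · simp [h]
      · have h' : ¬ p.1 = τ p.1 := fun e => h e.symm
        simp [h, h', hτ])
    (fun p h => hρne p.1 (congrArg Prod.fst h))
    (fun p => by
      by_cases h : τ p.1 = p.1
      · simp [h, Prod.ext_iff]
      · simp [h, Prod.ext_iff])
  refine ⟨fun d => c (d, false), fun d => hcρ (d, false), fun d hd => ?_⟩
  have := hcτ (d, false)
  simpa [hd] using this

/-- A matching of `H`, encoded as an involution moving each covered vertex to its partner. -/
structure IsMatchingMap (H : SimpleGraph V) (m : V → V) : Prop where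
  invol : ∀ v, m (m v) = v
  adj : ∀ v, m v ≠ v → H.Adj v (m v)

theorem IsCubic.exists_neighbors {G : SimpleGraph V} (hG : IsCubic G) {v t : V} (ht : G.Adj v t) :
    ∃ p q, t ≠ p ∧ t ≠ q ∧ p ≠ q ∧ ∀ w, G.Adj v w ↔ w = t ∨ w = p ∨ w = q := by
  obtain ⟨x, y, z, hxy, hxz, hyz, h⟩ := Set.ncard_eq_three.mp (hG v)
  have hw : ∀ w, G.Adj v w ↔ w = x ∨ w = y ∨ w = z := by
    intro w
    rw [← SimpleGraph.mem_neighborSet, h]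
    simp
  rcases (hw t).mp ht with rfl | rfl | rfl
  · exact ⟨y, z, hxy, hxz, hyz, hw⟩
  · exact ⟨x, z, hxy.symm, hyz, hxz, fun w => by rw [hw]; tauto⟩
  · exact ⟨x, y, hxz.symm, hyz.symm, hxy, fun w => by rw [hw]; tauto⟩

theorem IsCubic.exists_adj {G : SimpleGraph V} (hG : IsCubic G) (v : V) : ∃ w, G.Adj v w := by
  have h : (G.neighborSet v).Nonempty := by
    rw [Set.nonempty_iff_ne_empty]
    intro h
    have := hG v
    rw [h, Set.ncard_empty] at this
    omega
  exact h

theorem IsCubic.exists_third_neighbor {G : SimpleGraph V} (hG : IsCubic G) {v s t : V}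
    (hs : G.Adj v s) (ht : G.Adj v t) (hst : s ≠ t) :
    ∃ q, s ≠ q ∧ t ≠ q ∧ ∀ w, G.Adj v w ↔ w = s ∨ w = t ∨ w = q := by
  obtain ⟨p, q, hp, hq, hpq, hw⟩ := hG.exists_neighbors hs
  rcases (hw t).mp ht with rfl | rfl | rfl
  · exact absurd rfl hst
  · exact ⟨q, hq, hpq, hw⟩
  · exact ⟨p, hp, hpq.symm, fun w => by rw [hw]; tauto⟩

/-- Any two matchings of a cubic graph are simultaneously bichromatic for the colouring by
outdegree of some balanced orientation. -/
theorem exists_balanced_orientation {G : SimpleGraph V} (hG : IsCubic G) {f g : V → V}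
    (hf : IsMatchingMap G f) (hg : IsMatchingMap G g) :
    ∃ (D : Orientation G) (c : V → Bool), (∀ v, outDeg D v = if c v then 2 else 1) ∧
      (∀ v, f v ≠ v → c (f v) = !c v) ∧ ∀ v, g v ≠ v → c (g v) = !c v := by
  have hend : ∀ v, ∃ e p q, e ≠ p ∧ e ≠ q ∧ p ≠ q ∧ (∀ w, G.Adj v w ↔ w = e ∨ w = p ∨ w = q) ∧
      (f v ≠ v → e = f v) := by
    intro v
    by_cases hv : f v = v
    · obtain ⟨t, ht⟩ := hG.exists_adj v
      obtain ⟨p, q, h1, h2, h3, h4⟩ := hG.exists_neighbors ht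
      exact ⟨t, p, q, h1, h2, h3, h4, fun h => absurd hv h⟩
    · obtain ⟨p, q, h1, h2, h3, h4⟩ := hG.exists_neighbors (hf.adj v hv)
      exact ⟨f v, p, q, h1, h2, h3, h4, fun _ => rfl⟩
  choose e p q hep heq hpq hadj hef using hend
  have hae : ∀ v, G.Adj v (e v) := fun v => (hadj v _).mpr (Or.inl rfl)
  have hap : ∀ v, G.Adj v (p v) := fun v => (hadj v _).mpr (Or.inr (Or.inl rfl))
  have haq : ∀ v, G.Adj v (q v) := fun v => (hadj v _).mpr (Or.inr (Or.inr rfl))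
  let τ : G.Dart → G.Dart := fun d =>
    if d.snd = e d.fst then ⟨(g d.fst, e (g d.fst)), hae _⟩
    else if d.snd = p d.fst then ⟨(d.fst, q d.fst), haq _⟩
    else ⟨(d.fst, p d.fst), hap _⟩
  have hτe : ∀ v, τ ⟨(v, e v), hae v⟩ = ⟨(g v, e (g v)), hae _⟩ := fun v => by simp [τ]
  have hτp : ∀ v, τ ⟨(v, p v), hap v⟩ = ⟨(v, q v), haq v⟩ := fun v => by
    simp [τ, (hep v).symm]
  have hτq : ∀ v, τ ⟨(v, q v), haq v⟩ = ⟨(v, p v), hap v⟩ := fun v => by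
    simp [τ, (heq v).symm, (hpq v).symm]
  have hτ : ∀ d, τ (τ d) = d := by
    rintro ⟨⟨v, w⟩, hvw⟩
    rcases (hadj v w).mp hvw with rfl | rfl | rfl
    · rw [hτe, hτe]; simp [hg.invol]
    · rw [hτp, hτq]
    · rw [hτq, hτp]
  obtain ⟨c, hcρ, hcτ⟩ := exists_bool_coloring_of_involutive_of_free
    (SimpleGraph.Dart.symm : G.Dart → G.Dart) τ (fun d => d.symm_symm) hτ (fun d => d.symm_ne)
  have hflip : ∀ u v (h : G.Adj u v), c ⟨(v, u), h.symm⟩ = !c ⟨(u, v), h⟩ :=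
    fun u v h => hcρ ⟨(u, v), h⟩
  have hcpq : ∀ v, c ⟨(v, q v), haq v⟩ = !c ⟨(v, p v), hap v⟩ := by
    intro v
    have := hcτ ⟨(v, p v), hap v⟩
    rw [hτp] at this
    exact this (by simp [(hpq v).symm])
  let D : Orientation G :=
    { dir := fun u v => ∃ h : G.Adj u v, c ⟨(u, v), h⟩ = true
      adj_of_dir := fun u v h => h.1
      dir_iff_not := fun u v h => by
        have := hflip u v h
        constructor
        · rintro ⟨h', hc⟩ ⟨h'', hc'⟩
          rw [this, hc] at hc'
          simp at hc'
        · intro hn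
          refine ⟨h, ?_⟩
          by_contra hc
          exact hn ⟨h.symm, by rw [this]; simpa using hc⟩ }
  have hdir : ∀ u v (h : G.Adj u v), D.dir u v ↔ c ⟨(u, v), h⟩ = true :=
    fun u v h => ⟨fun h' => h'.2, fun h' => ⟨h, h'⟩⟩
  refine ⟨D, fun v => c ⟨(v, e v), hae v⟩, fun v => ?_, fun v hv => ?_, fun v hv => ?_⟩
  · have hset : ∃ x, e v ≠ x ∧
        {y | D.dir v y} = if c ⟨(v, e v), hae v⟩ then {e v, x} else {x} := by
      have key : ∀ y, D.dir v y ↔ (y = e v ∧ c ⟨(v, e v), hae v⟩ = true) ∨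
          (y = p v ∧ c ⟨(v, p v), hap v⟩ = true) ∨ (y = q v ∧ c ⟨(v, q v), haq v⟩ = true) := by
        intro y
        constructor
        · rintro ⟨h, hc⟩
          rcases (hadj v y).mp h with rfl | rfl | rfl <;> simp [hc]
        · rintro (⟨rfl, hc⟩ | ⟨rfl, hc⟩ | ⟨rfl, hc⟩)
          · exact ⟨_, hc⟩
          · exact ⟨_, hc⟩
          · exact ⟨_, hc⟩
      by_cases hp : c ⟨(v, p v), hap v⟩ = true
      · refine ⟨p v, hep v, Set.ext fun y => ?_⟩
        have hq := hcpq v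
        rw [hp] at hq
        rw [Set.mem_ofPred_eq, key, hp, hq]
        split_ifs with he <;> simp [he]
      · refine ⟨q v, heq v, Set.ext fun y => ?_⟩
        rw [Bool.not_eq_true] at hp
        have hq := hcpq v
        rw [hp] at hq
        rw [Set.mem_ofPred_eq, key, hp, hq]
        split_ifs with he <;> simp [he]
    obtain ⟨x, hx, hset⟩ := hset
    rw [outDeg, hset]
    dsimp only
    split_ifs with he
    · exact Set.ncard_pair hx
    · exact Set.ncard_singleton x
  · have hfv : f (f v) ≠ f v := by rw [hf.invol]; exact hv.symm
    have h1 : e v = f v := hef v hv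
    have h2 : e (f v) = v := by rw [hef _ hfv, hf.invol]
    have := hflip v (f v) (hf.adj v hv)
    simpa only [h1, h2] using this
  · have := hcτ ⟨(v, e v), hae v⟩
    rw [hτe] at this
    exact this (by simp [hv])

/-- In an orientation of a finite cubic graph with outdegrees one and two, both values are taken
equally often. -/
theorem card_filter_outDeg [Fintype V] {G : SimpleGraph V} (hG : IsCubic G) (D : Orientation G)
    {c : V → Bool} (hc : ∀ v, outDeg D v = if c v then 2 else 1) :
    {v | c v = false}.ncard = {v | c v = true}.ncard := by
  have hout : ∀ v, outDeg D v = ∑ w, if D.dir v w then 1 else 0 := by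
    intro v
    rw [outDeg, Set.ncard_eq_toFinset_card', Finset.sum_boole]
    simp
  have hin : ∀ v, outDeg D v + (∑ w, if D.dir w v then 1 else 0) = 3 := by
    intro v
    rw [hout, ← Finset.sum_add_distrib, ← hG v, Set.ncard_eq_toFinset_card',
      Finset.card_eq_sum_ones, ← Finset.sum_subset (Finset.subset_univ (G.neighborSet v).toFinset)]
    · refine Finset.sum_congr rfl fun w hw => ?_
      have := D.dir_iff_not v w (by simpa using hw)
      by_cases h : D.dir w v <;> simp [this, h]
    · intro w _ hw
      have h1 : ¬ D.dir v w := fun h => hw (by simpa using D.adj_of_dir _ _ h)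
      have h2 : ¬ D.dir w v := fun h => hw (by simpa using (D.adj_of_dir _ _ h).symm)
      simp [h1, h2]
  have hsum : ∑ v, outDeg D v = ∑ v, ∑ w, if D.dir w v then 1 else 0 := by
    rw [Finset.sum_comm]
    exact Finset.sum_congr rfl fun v _ => hout v
  have htot : 2 * ∑ v, outDeg D v = 3 * Fintype.card V := by
    have := Finset.sum_congr rfl fun v (_ : v ∈ Finset.univ) => hin v
    rw [Finset.sum_add_distrib, ← hsum] at this
    simp only [Finset.sum_const, Finset.card_univ, smul_eq_mul] at this
    omega
  have hval : ∑ v, outDeg D v = Fintype.card V + #{v | c v = true} := by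
    rw [Finset.card_filter, ← Finset.card_univ, Finset.card_eq_sum_ones, ← Finset.sum_add_distrib]
    refine Finset.sum_congr rfl fun v _ => ?_
    rw [hc]; split_ifs <;> rfl
  have hpart := Finset.card_filter_add_card_filter_not (s := (Finset.univ : Finset V))
    (fun v => c v = true)
  rw [Set.ncard_eq_toFinset_card', Set.ncard_eq_toFinset_card']
  simp only [Bool.not_eq_true, Finset.card_univ, Set.toFinset_ofPred] at hpart ⊢
  omega

/-- Two disjoint matchings `f`, `g` of a cubic graph, covering all vertices between them and
leaving uncovered vertices suitably far apart, yield an orientable 5-weak bisection. -/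
theorem exists_orientable_kWeak_of_matchings [Fintype V] {G : SimpleGraph V} (hG : IsCubic G)
    {f g : V → V} (hf : IsMatchingMap G f) (hg : IsMatchingMap G g)
    (hdisj : ∀ v, f v ≠ v → g v ≠ f v) (hcov : ∀ v, f v = v → g v ≠ v)
    (hgg : ∀ v w, g v = v → g w = w → G.Adj v w → f v = w)
    (hff : ∀ v w, f v = v → f w = w → G.Adj v w → g v = w)
    (hfg : ∀ u x, f u = u → g x = x → G.Adj u x →
      ∃ y, G.Adj x y ∧ f x ≠ y ∧ y ≠ u ∧ g y ≠ y ∧ (g y = u ∨ G.Adj u (g y))) :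
    ∃ V₁ V₂ : Set V, KWeak G 5 V₁ V₂ ∧ Orientable G V₁ V₂ := by
  obtain ⟨D, c, hD, hcf, hcg⟩ := exists_balanced_orientation hG hf hg
  have hmono : ∀ v t w x z, G.Adj v t → c t ≠ c v → G.Adj v w → c w = c v → G.Adj v x →
      c x = c v → w ≠ x → G.Adj v z → z ≠ t → c z = c v := by
    intro v t w x z ht hct hw hcw hx hcx hwx hz hzt
    obtain ⟨p, q, -, -, -, hn⟩ := hG.exists_neighbors ht
    rw [hn] at hw hx hz
    grind
  have hcf' : ∀ v, f v ≠ v → c (f v) ≠ c v := fun v hv => by rw [hcf v hv]; simp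
  have hcg' : ∀ v, g v ≠ v → c (g v) ≠ c v := fun v hv => by rw [hcg v hv]; simp
  have hmixed : ∀ u x a b, f u = u → g x = x → G.Adj u x → c u = c x → G.Adj u a → c a = c u →
      a ≠ x → G.Adj x b → c b = c x → b ≠ u → False := by
    intro u x a b hu hx hux hc hua hca hax hxb hcb hbu
    have hgu : g u ≠ u := hcov u hu
    have hfx : f x ≠ x := fun h => hcov x h hx
    obtain ⟨y, hxy, hfy, hyu, hgy, hy⟩ := hfg u x hu hx hux
    have hcy : c y = c x := hmono x (f x) u b y (hf.adj x hfx) (hcf' x hfx) hux.symm hc hxb hcb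
      hbu.symm hxy hfy.symm
    rcases hy with hy | hy
    · exact hcg' y hgy (by rw [hy, hc, hcy])
    · refine hcg' y hgy ?_
      rw [hcy, ← hc]
      refine hmono u (g u) x a (g y) (hg.adj u hgu) (hcg' u hgu) hux hc.symm hua hca hax.symm hy ?_
      intro h
      exact hyu (by rw [← hg.invol y, h, hg.invol])
  have hside : ∀ b : Bool, WeakSide G 5 {v | c v = b} := by
    intro b
    refine isAcyclic_and_ncard_supp_le_three ?_ ?_
    · rintro ⟨v, hv⟩ ⟨x, hx⟩ ⟨y, hy⟩ ⟨z, hz⟩ hvx hvy hvz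
      simp only [SimpleGraph.comap_adj, Function.Embedding.subtype_apply, Subtype.mk.injEq,
        Set.mem_ofPred_eq] at *
      obtain ⟨t, ht, hct⟩ : ∃ t, G.Adj v t ∧ c t ≠ c v := by
        by_cases h : f v = v
        · exact ⟨g v, hg.adj v (hcov v h), hcg' v (hcov v h)⟩
        · exact ⟨f v, hf.adj v h, hcf' v h⟩
      obtain ⟨p, q, -, -, -, hn⟩ := hG.exists_neighbors ht
      rw [hn] at hvx hvy hvz
      grind
    · rintro ⟨v, hv⟩ ⟨w, hw⟩ ⟨x, hx⟩ ⟨y, hy⟩ hvw hvx hwy hxw hyv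
      simp only [SimpleGraph.comap_adj, Function.Embedding.subtype_apply, Subtype.mk.injEq,
        Set.mem_ofPred_eq, ne_eq] at *
      have huncovered : ∀ v x y, G.Adj v x → c x = c v → G.Adj v y → c y = c v → x ≠ y →
          f v = v ∨ g v = v := by
        intro v x y hvx hcx hvy hcy hxy
        by_contra! h
        exact hcg' v h.2 (hmono v (f v) x y (g v) (hf.adj v h.1) (hcf' v h.1) hvx hcx hvy hcy hxy
          (hg.adj v h.2) (hdisj v h.1))
      have hcvw : c v = c w := hv.trans hw.symm
      have hcxv : c x = c v := hx.trans hv.symm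
      have hcyw : c y = c w := hy.trans hw.symm
      rcases huncovered v w x hvw hcvw.symm hvx hcxv (Ne.symm hxw) with h1 | h1 <;>
        rcases huncovered w v y hvw.symm hcvw hwy hcyw (Ne.symm hyv) with h2 | h2
      · have := hff v w h1 h2 hvw
        exact hcg' v (hcov v h1) (by rw [this, hcvw])
      · exact hmixed v w x y h1 h2 hvw hcvw hvx hcxv hxw hwy hcyw hyv
      · exact hmixed w v y x h2 h1 hvw.symm hcvw.symm hwy hcyw hyv hvx hcxv hxw
      · have := hgg v w h1 h2 hvw
        exact hcf' v (fun h => hcov v h h1) (by rw [this, hcvw])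
  refine ⟨{v | c v = false}, {v | c v = true}, ⟨⟨?_, ?_, card_filter_outDeg hG D hD⟩, hside _,
    hside _⟩, D, fun v hv => ?_, fun v hv => ?_⟩
  · rw [Set.disjoint_left]
    intro v hv hv'
    simp only [Set.mem_ofPred_eq] at hv hv'
    simp [hv] at hv'
  · ext v
    cases h : c v <;> simp [h]
  · have : c v = false := hv
    simp [hD, this]
  · have : c v = true := hv
    simp [hD, this]

theorem IsMatchingMap.id (H : SimpleGraph V) : IsMatchingMap H (fun v => v) :=
  ⟨fun _ => rfl, fun _ h => absurd rfl h⟩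

/-- Adding an edge between two uncovered vertices to a matching. -/
theorem IsMatchingMap.exists_insert {H : SimpleGraph V} {m : V → V} (hm : IsMatchingMap H m)
    {a b : V} (ha : m a = a) (hb : m b = b) (hab : H.Adj a b) :
    ∃ m', IsMatchingMap H m' ∧ m' a = b ∧ m' b = a ∧ ∀ v, v ≠ a → v ≠ b → m' v = m v := by
  have hne := hab.ne
  have hinv := hm.invol
  refine ⟨fun v => if v = a then b else if v = b then a else m v, ⟨fun v => ?_, fun v hv => ?_⟩,
    by simp, by simp, fun v h1 h2 => by simp [h1, h2]⟩
  · grind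
  · split_ifs at hv ⊢ with h1 h2
    · rw [h1]; exact hab
    · rw [h2]; exact hab.symm
    · exact hm.adj v hv

/-- Every matching extends to a maximal one. -/
theorem IsMatchingMap.exists_maximal [Fintype V] {H : SimpleGraph V} {m : V → V}
    (hm : IsMatchingMap H m) :
    ∃ m', IsMatchingMap H m' ∧ (∀ v, m v ≠ v → m' v = m v) ∧
      ∀ v w, m' v = v → m' w = w → ¬ H.Adj v w := by
  induction hk : #{v | m v = v} using Nat.strong_induction_on generalizing m with
  | _ k ih =>
    by_cases hmax : ∀ v w, m v = v → m w = w → ¬ H.Adj v w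
    · exact ⟨m, hm, fun _ _ => rfl, hmax⟩
    · push Not at hmax
      obtain ⟨a, b, ha, hb, hab⟩ := hmax
      obtain ⟨m₁, hm₁, h1, h2, h3⟩ := hm.exists_insert ha hb hab
      have hext : ∀ v, m v ≠ v → m₁ v = m v := fun v hv =>
        h3 v (fun h => hv (h ▸ ha)) (fun h => hv (h ▸ hb))
      have hlt : #{v | m₁ v = v} < k := by
        rw [← hk]
        refine Finset.card_lt_card ((Finset.ssubset_iff_of_subset ?_).mpr ⟨a, by simpa using ha, ?_⟩)
        · intro v hv
          simp only [Finset.mem_filter_univ] at hv ⊢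
          by_contra h
          exact h ((hext v h).symm.trans hv)
        · simpa [h1] using hab.ne.symm
      obtain ⟨m', hm', hext', hmax'⟩ := ih _ hlt hm₁ rfl
      refine ⟨m', hm', fun v hv => ?_, hmax'⟩
      rw [hext' v (by rw [hext v hv]; exact hv), hext v hv]

/-- The local matching near a vertex `u` with neighbours `a`, `b` whose only further neighbours are
`a'`, `b'`; the vertex `u` itself is left uncovered exactly when `P` holds. -/
theorem exists_local_matching {R : SimpleGraph V} {u a b a' b' : V} (P : Prop)
    (hab : a ≠ b) (hua : R.Adj u a) (hub : R.Adj u b) (haa' : R.Adj a a') (hbb' : R.Adj b b')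
    (ha'u : a' ≠ u) (hb'u : b' ≠ u) (ha : ∀ y, R.Adj a y → y = u ∨ y = a')
    (hb : ∀ y, R.Adj b y → y = u ∨ y = b') :
    ∃ h : V → V, IsMatchingMap R h ∧
      (∀ x, h x ≠ x → x = u ∨ x = a ∨ x = b ∨ x = a' ∨ x = b') ∧ (h u = u ↔ P) ∧
      ∀ x, x = a ∨ x = b → h x = x →
        ∃ y, R.Adj x y ∧ y ≠ u ∧ h y ≠ y ∧ (h y = u ∨ R.Adj u (h y)) := by
  have hau := hua.ne
  have hbu := hub.ne
  have haa'ne := haa'.ne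
  have hbb'ne := hbb'.ne
  by_cases hP : P
  · by_cases htri : a' = b
    · subst htri
      obtain ⟨h, hh, h1, h2, h3⟩ := (IsMatchingMap.id R).exists_insert rfl rfl haa'
      exact ⟨h, hh, by grind, by grind, by grind⟩
    · have hb'a : b' ≠ a := by
        rintro rfl
        have := ha b hbb'.symm
        grind
      obtain ⟨h, hh, h1, h2, h3⟩ := (IsMatchingMap.id R).exists_insert rfl rfl haa'
      by_cases hquad : a' = b'
      · subst hquad
        refine ⟨h, hh, by grind, by grind, ?_⟩
        rintro x (rfl | rfl) hx
        · grind
        · exact ⟨a', hbb', ha'u, by grind, Or.inr (by rw [h2]; exact hua)⟩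
      · obtain ⟨k, hk, k1, k2, k3⟩ := hh.exists_insert (a := b) (b := b') (by grind) (by grind) hbb'
        exact ⟨k, hk, by grind, by grind, by grind⟩
  · obtain ⟨h, hh, h1, h2, h3⟩ := (IsMatchingMap.id R).exists_insert rfl rfl hua
    by_cases htri : a' = b
    · subst htri
      refine ⟨h, hh, by grind, by grind, ?_⟩
      rintro x (rfl | rfl) hx
      · grind
      · exact ⟨a, haa'.symm, by grind, by grind, Or.inl h2⟩
    · have hb'a : b' ≠ a := by
        rintro rfl
        have := ha b hbb'.symm
        grind
      obtain ⟨k, hk, k1, k2, k3⟩ := hh.exists_insert (a := b) (b := b') (by grind) (by grind) hbb'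
      exact ⟨k, hk, by grind, by grind, by grind⟩

/-- A cubic graph with a matching `f` whose uncovered vertices `u` lie in disjoint sets `X u`, each
left by a single edge and that at `u`, has an orientable 5-weak bisection. -/
theorem exists_orientable_kWeak_of_pendant_sets [Fintype V] {G : SimpleGraph V} (hG : IsCubic G)
    {f : V → V} (hf : IsMatchingMap G f) (X : V → Set V) (k : V → V)
    (hX : ∀ u, f u = u → u ∈ X u)
    (hk : ∀ u, f u = u → G.Adj u (k u) ∧ k u ∉ X u)
    (hcut : ∀ u, f u = u → ∀ x ∈ X u, ∀ y, y ∉ X u → G.Adj x y → x = u ∧ y = k u)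
    (hdisj : ∀ u w, f u = u → f w = w → u ≠ w → Disjoint (X u) (X w)) :
    ∃ V₁ V₂ : Set V, KWeak G 5 V₁ V₂ ∧ Orientable G V₁ V₂ := by
  have huniq : ∀ u w x, f u = u → f w = w → x ∈ X u → x ∈ X w → u = w := by
    intro u w x hu hw hxu hxw
    by_contra h
    exact Set.disjoint_left.mp (hdisj u w hu hw h) hxu hxw
  let R : SimpleGraph V :=
    { Adj := fun v w => G.Adj v w ∧ f v ≠ w
      symm := ⟨fun v w h => ⟨h.1.symm, fun e => h.2 (by rw [← e, hf.invol])⟩⟩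
      loopless := ⟨fun v h => h.1.ne rfl⟩ }
  let Z : SimpleGraph V :=
    { Adj := fun v w => R.Adj v w ∧ ∀ u, f u = u → v ∈ X u → w ∉ X u
      symm := ⟨fun v w h => ⟨h.1.symm, fun u hu hw hv => h.2 u hu hv hw⟩⟩
      loopless := ⟨fun v h => h.1.ne rfl⟩ }
  have hRadj : ∀ u, f u = u → ∀ x, G.Adj u x → R.Adj u x :=
    fun u hu x hx => ⟨hx, by rw [hu]; exact hx.ne⟩
  have hZadj : ∀ u, f u = u → ∀ x, Z.Adj u x → x = k u :=
    fun u hu x hx => (hcut u hu u (hX u hu) x (hx.2 u hu (hX u hu)) hx.1.1).2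
  have hZout : ∀ u, f u = u → ∀ x, G.Adj u x → x ∉ X u → Z.Adj u x := by
    intro u hu x hx hxu
    refine ⟨hRadj u hu x hx, fun w hw huw => ?_⟩
    rwa [← huniq u w u hu hw (hX u hu) huw]
  obtain ⟨N, hN, -, hNmax⟩ := (IsMatchingMap.id Z).exists_maximal
  have hNX : ∀ u, f u = u → ∀ x ∈ X u, x ≠ u → N x = x := by
    intro u hu x hx hxu
    by_contra h
    have hadj := hN.adj x h
    exact hxu (hcut u hu x hx (N x) (hadj.2 u hu hx) hadj.1.1).1
  have hNk : ∀ u, f u = u → ∀ x, G.Adj u x → x ∉ X u → N x ≠ x := by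
    intro u hu x hx hxu hNx
    have hZ := hZout u hu x hx hxu
    have hNu : N u ≠ u := fun h => hNmax u x h hNx hZ
    have hNux : N u = x := (hZadj u hu _ (hN.adj u hNu)).trans (hZadj u hu x hZ).symm
    exact hx.ne (by rw [← hNx, ← hNux, hN.invol])
  have hlocal : ∀ u, ∃ h : V → V, IsMatchingMap R h ∧ (∀ x, h x ≠ x → f u = u ∧ x ∈ X u) ∧
      (f u = u → ((h u = u ↔ N u ≠ u) ∧ ∀ x ∈ X u, G.Adj u x → h x = x →
        ∃ y, R.Adj x y ∧ y ≠ u ∧ h y ≠ y ∧ (h y = u ∨ G.Adj u (h y)))) := by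
    intro u
    by_cases hu : f u = u
    swap
    · exact ⟨fun v => v, IsMatchingMap.id R, fun x hx => absurd rfl hx, fun h => absurd h hu⟩
    obtain ⟨a, b, hka, hkb, hab, hnbr⟩ := hG.exists_neighbors (hk u hu).1
    have hmem : ∀ x, G.Adj u x → x ≠ k u → x ∈ X u := by
      intro x hx hxk
      by_contra h
      exact hxk (hcut u hu u (hX u hu) x h hx).2
    have hua : G.Adj u a := (hnbr a).mpr (by simp)
    have hub : G.Adj u b := (hnbr b).mpr (by simp)
    have hother : ∀ x, G.Adj u x → x ∈ X u → ∃ x', x' ∈ X u ∧ R.Adj x x' ∧ x' ≠ u ∧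
        ∀ y, R.Adj x y → y = u ∨ y = x' := by
      intro x hux hx
      have hfx : f x ≠ x := fun h => hux.ne (huniq u x x hu h hx (hX x h))
      have hfxu : f x ≠ u := fun h => hux.ne (by rw [← hu, ← h, hf.invol])
      obtain ⟨x', h1, h2, h3⟩ := hG.exists_third_neighbor (hf.adj x hfx) hux.symm hfxu
      have hxx' : G.Adj x x' := (h3 x').mpr (by simp)
      refine ⟨x', ?_, ⟨hxx', h1⟩, h2.symm, fun y hy => ?_⟩
      · by_contra h
        exact hux.ne (hcut u hu x hx x' h hxx').1.symm
      · rcases (h3 y).mp hy.1 with rfl | h | h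
        · exact absurd rfl hy.2
        · exact Or.inl h
        · exact Or.inr h
    have haX := hmem a hua hka.symm
    have hbX := hmem b hub hkb.symm
    obtain ⟨a', ha'X, haa', ha'u, ha⟩ := hother a hua haX
    obtain ⟨b', hb'X, hbb', hb'u, hb⟩ := hother b hub hbX
    obtain ⟨h, hh, hsupp, hhu, hbad⟩ := exists_local_matching (N u ≠ u) hab (hRadj u hu a hua)
      (hRadj u hu b hub) haa' hbb' ha'u hb'u ha hb
    refine ⟨h, hh, fun x hx => ⟨hu, ?_⟩, fun _ => ⟨hhu, fun x hx hux hhx => ?_⟩⟩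
    · rcases hsupp x hx with rfl | rfl | rfl | rfl | rfl
      exacts [hX _ hu, haX, hbX, ha'X, hb'X]
    · have hxab : x = a ∨ x = b := by
        rcases (hnbr x).mp hux with rfl | h | h
        · exact absurd hx (hk u hu).2
        · exact Or.inl h
        · exact Or.inr h
      obtain ⟨y, h1, h2, h3, h4⟩ := hbad x hxab hhx
      exact ⟨y, h1, h2, h3, h4.imp_right fun h => h.1⟩
  choose h hh hsupp hbad using hlocal
  have hroot : ∀ v, ∃ r, ∀ u, f u = u → v ∈ X u → r = u := by
    intro v
    by_cases hv : ∃ u, f u = u ∧ v ∈ X u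
    · obtain ⟨u, hu, hvu⟩ := hv
      exact ⟨u, fun w hw hvw => huniq u w v hu hw hvu hvw⟩
    · exact ⟨v, fun u hu hvu => absurd ⟨u, hu, hvu⟩ hv⟩
  choose r hr using hroot
  have hhN : ∀ u x, h u x ≠ x → N x = x := by
    intro u x hx
    obtain ⟨hu, hxu⟩ := hsupp u x hx
    by_cases hxu' : x = u
    · rw [hxu'] at hx ⊢
      by_contra hne
      exact hx ((hbad u hu).1.mpr hne)
    · exact hNX u hu x hxu hxu'
  let J : V → V := fun v => if N v = v then h (r v) v else N v
  have hJN : ∀ v, N v ≠ v → J v = N v := fun v hv => by simp [J, hv]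
  have hJh : ∀ u v, h u v ≠ v → J v = h u v := by
    intro u v hv
    obtain ⟨hu, hvu⟩ := hsupp u v hv
    simp only [J, hhN u v hv, if_true, hr v u hu hvu]
  have hJ : IsMatchingMap R J := by
    constructor
    · intro v
      by_cases hv : N v = v
      · by_cases hhv : h (r v) v = v
        · simp [J, hv, hhv]
        · have h1 : h (r v) (h (r v) v) ≠ h (r v) v := by
            rw [(hh _).invol]; exact fun e => hhv e.symm
          rw [hJh _ v hhv, hJh _ _ h1, (hh _).invol]
      · have h1 : N (N v) ≠ N v := by
          rw [hN.invol]; exact fun e => hv e.symm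
        rw [hJN v hv, hJN _ h1, hN.invol]
    · intro v hv
      by_cases hNv : N v = v
      · have hJv : J v = h (r v) v := by simp [J, hNv]
        rw [hJv] at hv ⊢
        exact (hh _).adj v hv
      · rw [hJN v hNv]
        exact (hN.adj v hNv).1
  obtain ⟨g, hg, hgJ, hgmax⟩ := hJ.exists_maximal
  have hgN : ∀ v, N v ≠ v → g v = N v := fun v hv => by
    rw [hgJ v (by rw [hJN v hv]; exact hv), hJN v hv]
  have hgh : ∀ u v, h u v ≠ v → g v = h u v := fun u v hv => by
    rw [hgJ v (by rw [hJh u v hv]; exact hv), hJh u v hv]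
  refine exists_orientable_kWeak_of_matchings hG hf (g := g)
    ⟨hg.invol, fun v hv => (hg.adj v hv).1⟩ ?_ ?_ ?_ ?_ ?_
  · intro v _ hgf
    by_cases hgv : g v = v
    · exact absurd (hgf.symm.trans hgv) ‹f v ≠ v›
    · exact (hg.adj v hgv).2 hgf.symm
  · intro v hv
    by_cases hNv : N v = v
    · have hhv : h v v ≠ v := fun e => (hbad v hv).1.mp e hNv
      rw [hgh v v hhv]; exact hhv
    · rw [hgN v hNv]; exact hNv
  · intro v w hv hw hvw
    by_contra hne
    exact hgmax v w hv hw ⟨hvw, hne⟩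
  · intro v w hv hw hvw
    have hout : ∀ v w, f v = v → f w = w → G.Adj v w → w ∉ X v := fun v w hv hw hvw hwv =>
      hvw.ne (huniq v w w hv hw hwv (hX w hw))
    have hNv : N v ≠ v := hNk w hw v hvw.symm (hout w v hw hv hvw.symm)
    rw [hgN v hNv, hZadj v hv _ (hN.adj v hNv), hZadj v hv w (hZout v hv w hvw (hout v w hv hw hvw))]
  · intro u x hu hx hux
    by_cases hxu : x ∈ X u
    · have hhx : h u x = x := by
        by_contra hne
        exact hne ((hgh u x hne).symm.trans hx)
      obtain ⟨y, hxy, hyu, hhy, hy⟩ := (hbad u hu).2 x hxu hux hhx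
      have hgy := hgh u y hhy
      rw [← hgy] at hhy hy
      exact ⟨y, hxy.1, hxy.2, hyu, hhy, hy⟩
    · have hNx := hNk u hu x hux hxu
      exact absurd ((hgN x hNx).symm.trans hx) hNx

/-- The number of edges leaving the set `A`. -/
noncomputable def cutSize [Fintype V] (G : SimpleGraph V) (A : Finset V) : ℕ :=
  #{p : V × V | p.1 ∈ A ∧ p.2 ∉ A ∧ G.Adj p.1 p.2}

theorem cutSize_compl [Fintype V] (G : SimpleGraph V) (A : Finset V) :
    cutSize G Aᶜ = cutSize G A := by
  refine Finset.card_bij' (fun p _ => p.swap) (fun p _ => p.swap) ?_ ?_ ?_ ?_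
  · rintro ⟨x, y⟩ h
    simp only [Finset.mem_filter_univ, Finset.mem_compl, not_not, Prod.swap] at h ⊢
    exact ⟨h.2.1, h.1, h.2.2.symm⟩
  · rintro ⟨x, y⟩ h
    simp only [Finset.mem_filter_univ, Finset.mem_compl, not_not, Prod.swap] at h ⊢
    exact ⟨h.2.1, h.1, h.2.2.symm⟩
  · simp
  · simp

theorem cutSize_inter_add_cutSize_union_le [Fintype V] (G : SimpleGraph V) (A B : Finset V) :
    cutSize G (A ∩ B) + cutSize G (A ∪ B) ≤ cutSize G A + cutSize G B := by
  simp only [cutSize, Finset.card_filter, ← Finset.sum_add_distrib]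
  refine Finset.sum_le_sum fun p _ => ?_
  by_cases h1 : p.1 ∈ A <;> by_cases h2 : p.1 ∈ B <;> by_cases h3 : p.2 ∈ A <;>
    by_cases h4 : p.2 ∈ B <;> simp [h1, h2, h3, h4]

theorem cutSize_sdiff_add_cutSize_sdiff_le [Fintype V] (G : SimpleGraph V) (A B : Finset V) :
    cutSize G (A \ B) + cutSize G (B \ A) ≤ cutSize G A + cutSize G B := by
  have h := cutSize_inter_add_cutSize_union_le G A Bᶜ
  rw [cutSize_compl, ← Finset.sdiff_eq_inter_compl] at h
  rwa [← cutSize_compl G (B \ A), show (B \ A)ᶜ = A ∪ Bᶜ by ext; simp; tauto]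

theorem IsCubic.card_filter_adj [Fintype V] {G : SimpleGraph V} (hG : IsCubic G) (A : Finset V) :
    #{p : V × V | p.1 ∈ A ∧ G.Adj p.1 p.2} = 3 * #A := by
  rw [Finset.card_filter, Fintype.sum_prod_type, mul_comm, ← smul_eq_mul, ← Finset.sum_const,
    ← Finset.sum_subset (Finset.subset_univ A)]
  · refine Finset.sum_congr rfl fun x hx => ?_
    rw [← hG x, Set.ncard_eq_toFinset_card', ← Finset.card_filter]
    congr 1
    ext y
    simp [hx]
  · intro x _ hx
    simp [hx]

theorem IsCubic.odd_cutSize_iff [Fintype V] {G : SimpleGraph V} (hG : IsCubic G) (A : Finset V) :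
    Odd (cutSize G A) ↔ Odd #A := by
  have hsplit : cutSize G A + #{p : V × V | p.1 ∈ A ∧ p.2 ∈ A ∧ G.Adj p.1 p.2} = 3 * #A := by
    rw [← hG.card_filter_adj, cutSize, ← Finset.card_union_of_disjoint]
    · congr 1
      ext p
      simp only [Finset.mem_union, Finset.mem_filter_univ]
      tauto
    · rw [Finset.disjoint_left]
      intro p hp hp'
      simp only [Finset.mem_filter_univ] at hp hp'
      exact hp.2.1 hp'.2.1
  have heven : Even #{p : V × V | p.1 ∈ A ∧ p.2 ∈ A ∧ G.Adj p.1 p.2} := by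
    rw [← ZMod.natCast_eq_zero_iff_even, Finset.card_eq_sum_ones, Nat.cast_sum]
    refine Finset.sum_involution (fun p _ => p.swap) ?_ ?_ ?_ ?_
    · intro p _; decide
    · rintro ⟨x, y⟩ hp _ he
      simp only [Finset.mem_filter_univ] at hp
      exact hp.2.2.ne (congrArg Prod.snd he)
    · rintro ⟨x, y⟩ hp
      simp only [Finset.mem_filter_univ, Prod.swap] at hp ⊢
      exact ⟨hp.2.1, hp.1, hp.2.2.symm⟩
    · simp
  have h3 : Odd (3 * #A) ↔ Odd #A := by
    rw [Nat.odd_mul]; simp [show Odd 3 by decide]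
  rw [← h3, ← hsplit, Nat.odd_add]
  simp [heven]

/-- A minimal set left by exactly one edge. -/
def IsPendant [Fintype V] (G : SimpleGraph V) (X : Finset V) : Prop :=
  Minimal (fun Y => cutSize G Y = 1) X

theorem IsPendant.disjoint [Fintype V] {G : SimpleGraph V} (hG : IsCubic G) {X Y : Finset V}
    (hX : IsPendant G X) (hY : IsPendant G Y) (hne : X ≠ Y) : Disjoint X Y := by
  have hoX : Odd #X := (hG.odd_cutSize_iff X).mp (by rw [hX.prop]; decide)
  have hoY : Odd #Y := (hG.odd_cutSize_iff Y).mp (by rw [hY.prop]; decide)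
  have h1 := cutSize_inter_add_cutSize_union_le G X Y
  have h2 := cutSize_sdiff_add_cutSize_sdiff_le G X Y
  rw [hX.prop, hY.prop] at h1 h2
  have hpos : ∀ A : Finset V, Odd #A → 1 ≤ cutSize G A := fun A hA =>
    ((hG.odd_cutSize_iff A).mpr hA).pos
  have hcardX := Finset.card_sdiff_add_card_inter X Y
  have hcardY := Finset.card_sdiff_add_card_inter Y X
  have hunion := Finset.card_union_add_card_inter X Y
  rw [Finset.inter_comm] at hcardY
  by_cases ho : Odd #(X ∩ Y)
  · have h3 := hpos _ ho
    have h4 := hpos (X ∪ Y) (by grind)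
    have h5 : cutSize G (X ∩ Y) = 1 := by omega
    have hXY := hX.le_of_le h5 Finset.inter_subset_left
    have hYX := hY.le_of_le h5 Finset.inter_subset_right
    exact absurd (Finset.Subset.antisymm (fun x hx => (Finset.mem_inter.mp (hXY hx)).2)
      (fun x hx => (Finset.mem_inter.mp (hYX hx)).1)) hne
  · have h3 := hpos (X \ Y) (by grind)
    have h4 := hpos (Y \ X) (by grind)
    have h5 : cutSize G (X \ Y) = 1 := by omega
    have hXY := hX.le_of_le h5 Finset.sdiff_subset
    rw [Finset.disjoint_left]
    exact fun x hx => (Finset.mem_sdiff.mp (hXY hx)).2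

theorem exists_isPendant_subset [Fintype V] {G : SimpleGraph V} {A : Finset V}
    (hA : cutSize G A = 1) : ∃ X ⊆ A, IsPendant G X :=
  exists_minimal_le_of_wellFoundedLT (fun Y => cutSize G Y = 1) A hA

theorem exists_unique_cut_edge [Fintype V] {G : SimpleGraph V} {X : Finset V}
    (hX : cutSize G X = 1) : ∃ u k, u ∈ X ∧ k ∉ X ∧ G.Adj u k ∧
      ∀ x ∈ X, ∀ y, y ∉ X → G.Adj x y → x = u ∧ y = k := by
  obtain ⟨⟨u, k⟩, h⟩ := Finset.card_eq_one.mp hX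
  have hmem : ∀ x y, (x ∈ X ∧ y ∉ X ∧ G.Adj x y) ↔ x = u ∧ y = k := by
    intro x y
    have := Finset.ext_iff.mp h (x, y)
    simpa using this
  have huk := (hmem u k).mpr ⟨rfl, rfl⟩
  exact ⟨u, k, huk.1, huk.2.1, huk.2.2, fun x hx y hy hxy => (hmem x y).mp ⟨hx, hy, hxy⟩⟩

/-- The ends, inside pendant sets, of the edges leaving them. -/
def pendantRoots [Fintype V] (G : SimpleGraph V) : Set V :=
  {u | ∃ X, IsPendant G X ∧ u ∈ X ∧ ∃ y, y ∉ X ∧ G.Adj u y}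

/-- Joining all pendant roots of a cubic graph to each other creates a perfect matching. -/
theorem exists_isPerfectMatching_of_pendantRoots [Fintype V] {G G' : SimpleGraph V}
    (hG : IsCubic G) (hle : G ≤ G')
    (hroots : ∀ v ∈ pendantRoots G, ∀ w ∈ pendantRoots G, v ≠ w → G'.Adj v w) :
    ∃ M : G'.Subgraph, M.IsPerfectMatching := by
  rw [SimpleGraph.tutte]
  intro S hS
  rw [SimpleGraph.IsTutteViolator] at hS
  set H := ((⊤ : G'.Subgraph).deleteVerts S) with hH
  have hverts : ∀ v, v ∈ H.verts ↔ v ∉ S := by simp [hH]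
  have hHadj : ∀ a b : H.verts, G'.Adj a b → H.coe.Adj a b := by
    intro a b hab
    have ha := (hverts a).mp a.2
    have hb := (hverts b).mp b.2
    simp [hH, ha, hb, hab]
  have heven : ¬ Odd (Nat.card V) := by
    have h := (hG.odd_cutSize_iff Finset.univ)
    rw [Finset.card_univ] at h
    rw [Nat.card_eq_fintype_card, ← h]
    simp [cutSize]
  have hparity : Odd H.coe.oddComponents.ncard ↔ Odd S.ncard := by
    rw [SimpleGraph.odd_ncard_oddComponents]
    have hcard : Nat.card H.verts + S.ncard = Nat.card V := by
      have : H.verts = Sᶜ := Set.ext hverts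
      rw [Nat.card_coe_set_eq, this, add_comm, Set.ncard_add_ncard_compl]
    grind
  let Y : H.coe.ConnectedComponent → Finset V := fun c => c.supp.toFinset.image Subtype.val
  have hY : ∀ c v, v ∈ Y c ↔ ∃ hv : v ∈ H.verts, H.coe.connectedComponentMk ⟨v, hv⟩ = c := by
    intro c v
    simp [Y]
  have hYcard : ∀ c, #(Y c) = c.supp.ncard := by
    intro c
    rw [Finset.card_image_of_injective _ Subtype.val_injective, Set.ncard_eq_toFinset_card']
  have hYcut : ∀ c, ∀ x ∈ Y c, ∀ y, y ∉ Y c → G'.Adj x y → y ∈ S := by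
    intro c x hx y hy hxy
    by_contra hyS
    obtain ⟨hxH, hxc⟩ := (hY c x).mp hx
    have hyH := (hverts y).mpr hyS
    refine hy ((hY c y).mpr ⟨hyH, ?_⟩)
    rw [← hxc]
    exact SimpleGraph.ConnectedComponent.sound (hHadj ⟨y, hyH⟩ ⟨x, hxH⟩ hxy.symm).reachable
  let O : Finset H.coe.ConnectedComponent := H.coe.oddComponents.toFinset
  have hO : ∀ c, c ∈ O ↔ Odd #(Y c) := by
    intro c
    rw [hYcard]
    simp [O]
  let T := O.filter fun c => ∀ w ∈ pendantRoots G, w ∉ Y c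
  have hT : #O ≤ #T + 1 := by
    rw [← Finset.card_filter_add_card_filter_not (s := O)
      (fun c => ∀ w ∈ pendantRoots G, w ∉ Y c)]
    refine Nat.add_le_add_left (Finset.card_le_one.mpr ?_) _
    intro c hc d hd
    simp only [Finset.mem_filter] at hc hd
    obtain ⟨-, hc⟩ := hc
    obtain ⟨-, hd⟩ := hd
    push Not at hc hd
    obtain ⟨v, hv, hvc⟩ := hc
    obtain ⟨w, hw, hwd⟩ := hd
    obtain ⟨hvH, rfl⟩ := (hY c v).mp hvc
    obtain ⟨hwH, rfl⟩ := (hY d w).mp hwd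
    by_cases hvw : v = w
    · subst hvw; rfl
    · exact SimpleGraph.ConnectedComponent.sound
        (hHadj ⟨v, hvH⟩ ⟨w, hwH⟩ (hroots v hv w hw hvw)).reachable
  have hT3 : ∀ c ∈ T, 3 ≤ cutSize G (Y c) := by
    intro c hc
    simp only [T, Finset.mem_filter] at hc
    have hodd := (hG.odd_cutSize_iff _).mpr ((hO c).mp hc.1)
    by_contra hlt
    have h1 : cutSize G (Y c) = 1 := by grind
    obtain ⟨X, hXY, hX⟩ := exists_isPendant_subset h1
    obtain ⟨u, k, hu, hk, huk, -⟩ := exists_unique_cut_edge hX.prop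
    exact hc.2 u ⟨X, hX, hu, k, hk, huk⟩ (hXY hu)
  have hsum : ∑ c ∈ T, cutSize G (Y c) ≤ 3 * #S.toFinset := by
    rw [← hG.card_filter_adj]
    simp only [cutSize]
    rw [← Finset.card_biUnion]
    · refine Finset.card_le_card_of_injOn Prod.swap ?_ Prod.swap_injective.injOn
      rintro ⟨x, y⟩ hp
      simp only [Finset.coe_biUnion, Set.mem_iUnion, Finset.mem_coe, Finset.mem_filter_univ] at hp
      obtain ⟨c, -, hx, hy, hxy⟩ := hp
      simpa using ⟨hYcut c x hx y hy (hle hxy), hxy.symm⟩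
    · intro c _ d _ hcd
      refine Finset.disjoint_left.mpr ?_
      rintro ⟨x, y⟩ hc hd
      simp only [Finset.mem_filter_univ] at hc hd
      obtain ⟨h1, h2⟩ := (hY c x).mp hc.1
      obtain ⟨h3, h4⟩ := (hY d x).mp hd.1
      exact hcd (h2.symm.trans h4)
  have hmul : 3 * #T ≤ ∑ c ∈ T, cutSize G (Y c) := by
    rw [mul_comm, ← smul_eq_mul]
    exact Finset.card_nsmul_le_sum _ _ _ hT3
  have hOcard : #O = H.coe.oddComponents.ncard := (Set.ncard_eq_toFinset_card' _).symm
  rw [Set.ncard_eq_toFinset_card' S] at hS hparity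
  rw [← hOcard] at hS hparity
  grind

/-- every cubic graph admits an orientable 5-weak bisection. -/
theorem stmt17 [Fintype V] (G : SimpleGraph V) (hG : IsCubic G) :
    ∃ V₁ V₂ : Set V, KWeak G 5 V₁ V₂ ∧ Orientable G V₁ V₂ := by
  let G' : SimpleGraph V :=
    { Adj := fun v w => G.Adj v w ∨ (v ≠ w ∧ v ∈ pendantRoots G ∧ w ∈ pendantRoots G)
      symm := ⟨fun v w h => h.imp (fun h => h.symm) fun h => ⟨h.1.symm, h.2.2, h.2.1⟩⟩
      loopless := ⟨fun v h => h.elim (fun h => h.ne rfl) fun h => h.1 rfl⟩ }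
  obtain ⟨M, hM⟩ := exists_isPerfectMatching_of_pendantRoots (G' := G') hG
    (fun v w h => Or.inl h) (fun v hv w hw hvw => Or.inr ⟨hvw, hv, hw⟩)
  rw [SimpleGraph.Subgraph.isPerfectMatching_iff] at hM
  choose μ hμ hμuniq using hM
  have hμμ : ∀ v, μ (μ v) = v := fun v => (hμuniq (μ v) v (hμ v).symm).symm
  let f : V → V := fun v => if G.Adj v (μ v) then μ v else v
  have hfix : ∀ v, f v = v → ¬ G.Adj v (μ v) := by
    intro v hv h
    simp only [f, h, if_true] at hv
    exact h.ne hv.symm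
  have hf : IsMatchingMap G f := by
    refine ⟨fun v => ?_, fun v hv => ?_⟩
    · by_cases h : G.Adj v (μ v)
      · have h' : G.Adj (μ v) v := h.symm
        simp [f, h, h', hμμ]
      · simp [f, h]
    · by_cases h : G.Adj v (μ v)
      · simp [f, h]
      · simp [f, h] at hv
  have hpend : ∀ u, ∃ (X : Finset V) (k : V), f u = u → IsPendant G X ∧ u ∈ X ∧ k ∉ X ∧
      G.Adj u k ∧ ∀ x ∈ X, ∀ y, y ∉ X → G.Adj x y → x = u ∧ y = k := by
    intro u
    by_cases hu : f u = u
    · obtain ⟨X, hX, huX, y, hy, huy⟩ : u ∈ pendantRoots G :=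
        ((M.adj_sub (hμ u)).resolve_left (hfix u hu)).2.1
      obtain ⟨v, k, -, hk, -, hvk⟩ := exists_unique_cut_edge hX.prop
      obtain ⟨rfl, rfl⟩ := hvk u huX y hy huy
      exact ⟨X, y, fun _ => ⟨hX, huX, hk, huy, hvk⟩⟩
    · exact ⟨∅, u, fun h => absurd h hu⟩
  choose X k hXk using hpend
  refine exists_orientable_kWeak_of_pendant_sets hG hf (fun u => X u) k
    (fun u hu => (hXk u hu).2.1) (fun u hu => ⟨(hXk u hu).2.2.2.1, (hXk u hu).2.2.1⟩)
    (fun u hu => (hXk u hu).2.2.2.2) (fun u w hu hw huw => ?_)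
  rw [Finset.disjoint_coe]
  refine (hXk u hu).1.disjoint hG (hXk w hw).1 fun h => huw ?_
  obtain ⟨-, -, hkw, hwk, -⟩ := hXk w hw
  refine ((hXk u hu).2.2.2.2 w ?_ (k w) ?_ hwk).1.symm
  · rw [h]; exact (hXk w hw).2.1
  · rw [h]; exact hkw

end BEF
end

section
/- Every cubic graph G=(V,E) contains a spanning subgraph F each of whose connected components is either a path on at least two vertices or a cycle, such that: (1) the two endvertices of every path of F with an odd number of vertices are non-adjacent in G; (2) an endvertex of one path of F and an endvertex of a different path of F are never adjacent in G; (3) every odd cycle of F is an induced (chordless) cycle of G; (4) if a vertex of an odd cycle C of F is adjacent in G to a vertex x not on C, then x is an internal (non-end) vertex of a path of F with an odd number of vertices; and (5) for every path P of F with an odd number of vertices, all edges of G joining a vertex of P to a vertex of an odd cycle of F have their cycle-endvertex equal to a single common vertex of a single odd cycle of F. -/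
open Finset
open scoped Classical

namespace BEF

variable {V : Type*}

/-- `v` is an endvertex of a path component of `F` (i.e. has degree 1). -/
def IsPathEnd (F : SimpleGraph V) (v : V) : Prop := (F.neighborSet v).ncard = 1

/-- `v` lies on a cycle component of `F` with an odd number of vertices. -/
def InOddCycle (F : SimpleGraph V) (v : V) : Prop :=
  (∀ u, F.Reachable v u → (F.neighborSet u).ncard = 2) ∧
    Odd ((F.connectedComponentMk v).supp.ncard)

/-- `v` lies on a path component of `F` with an odd number of vertices. -/
def InOddPath (F : SimpleGraph V) (v : V) : Prop :=
  (∃ u, F.Reachable v u ∧ (F.neighborSet u).ncard = 1) ∧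
    Odd ((F.connectedComponentMk v).supp.ncard)

/-- A vertex of a cubic graph does not have four distinct neighbours. -/
theorem IsCubic.not_four_adj [Finite V] {G : SimpleGraph V} (hG : IsCubic G) {v a b c d : V}
    (ha : G.Adj v a) (hb : G.Adj v b) (hc : G.Adj v c) (hd : G.Adj v d)
    (hab : a ≠ b) (hac : a ≠ c) (had : a ≠ d) (hbc : b ≠ c) (hbd : b ≠ d) (hcd : c ≠ d) :
    False := by
  have hsub : (({a, b, c, d} : Finset V) : Set V) ⊆ G.neighborSet v := by
    intro x hx
    simp only [coe_insert, coe_singleton, Set.mem_insert_iff, Set.mem_singleton_iff] at hx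
    rcases hx with rfl | rfl | rfl | rfl <;> assumption
  have hle := Set.ncard_le_ncard hsub (Set.toFinite _)
  rw [hG v, Set.ncard_coe_finset] at hle
  have hcard : ({a, b, c, d} : Finset V).card = 4 := by
    rw [card_insert_of_notMem, card_insert_of_notMem, card_pair hcd] <;> simp [*]
  omega

/-- The first and last entries of the list `l` are adjacent. -/
def EndsAdj (G : SimpleGraph V) (l : List V) : Prop :=
  ∃ a ∈ l.head?, ∃ b ∈ l.getLast?, G.Adj a b

theorem isChain_of_isSegment {R : V → V → Prop} {l l₁ : List V} (h : l.IsChain R)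
    (hl : l₁ <:+: l) : l₁.IsChain R := by
  obtain ⟨s, t, rfl⟩ := hl
  exact (List.isChain_append.1 (List.isChain_append.1 h).1).2.1

theorem isChain_adj_reverse {G : SimpleGraph V} {l : List V} :
    l.reverse.IsChain G.Adj ↔ l.IsChain G.Adj := by
  rw [List.isChain_reverse]
  simp only [G.adj_comm]

/-- Rerouting through the initial vertex `p` of a path whose last vertex is adjacent to the vertex
`c` of an odd cycle, when `p` is adjacent to both neighbours of `c` on the cycle. -/
theorem exists_rerouted_path {G : SimpleGraph V} {p q c e d : V} {L s : List V}
    (hL : (p :: q :: L).IsChain G.Adj) (hLc : ∀ x ∈ (q :: L).getLast?, G.Adj x c)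
    (hC : (c :: e :: (s ++ [d] ++ [c])).IsChain G.Adj) (hpe : G.Adj p e) (hpd : G.Adj p d)
    (hq : ∀ x ∈ (s ++ [d]).head?, ¬ G.Adj q x) :
    ∃ l : List V, l.Perm (p :: q :: L ++ c :: e :: (s ++ [d])) ∧ l.IsChain G.Adj ∧
      ¬ EndsAdj G l := by
  refine ⟨q :: L ++ c :: e :: p :: (s ++ [d]).reverse, ?_, ?_, ?_⟩
  · classical
    rw [List.perm_iff_count]
    intro a
    simp only [List.count_append, List.count_cons, List.count_reverse]
    omega
  · have hs : (s ++ [d]).reverse.IsChain G.Adj := by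
      rw [isChain_adj_reverse]
      exact isChain_of_isSegment hC ⟨[c, e], [c], by simp⟩
    rw [List.isChain_append]
    refine ⟨hL.tail, ?_, ?_⟩
    · simp only [List.isChain_cons_cons] at hC
      simp only [List.isChain_cons_cons, hC.1, hpe.symm, true_and]
      rw [List.isChain_cons]
      exact ⟨by simpa using hpd, hs⟩
    · intro x hx y hy
      simp only [List.head?_cons, Option.mem_some_iff] at hy
      exact hy ▸ hLc x hx
  · rintro ⟨a, ha, b, hb, hab⟩
    simp only [List.cons_append, List.head?_cons, Option.mem_some_iff] at ha
    subst ha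
    refine hq b ?_ hab
    have : (q :: L ++ c :: e :: p :: (s ++ [d]).reverse) =
        (q :: L ++ [c, e, p]) ++ (s ++ [d]).reverse := by simp
    rw [this, List.getLast?_append_of_ne_nil _ (by simp), List.getLast?_reverse] at hb
    exact hb

theorem cycle_chain_reverse_tail {G : SimpleGraph V} {c : V} {t : List V}
    (h : (c :: (t ++ [c])).IsChain G.Adj) : (c :: (t.reverse ++ [c])).IsChain G.Adj := by
  rw [← isChain_adj_reverse]
  simpa using h

/-- An odd cycle and a disjoint path whose last vertex is adjacent to the cycle can be merged into
a single path with non-adjacent ends. -/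
theorem exists_merged_path [Finite V] {G : SimpleGraph V} (hG : IsCubic G) {c : V} {t L : List V}
    (hL : L.IsChain G.Adj) (hL2 : 2 ≤ L.length) (hLc : ∀ x ∈ L.getLast?, G.Adj x c)
    (hC : (c :: (t ++ [c])).IsChain G.Adj) (ht : Even t.length) (ht2 : 2 ≤ t.length)
    (hnd : (L ++ c :: t).Nodup) :
    ∃ l : List V, l.Perm (L ++ c :: t) ∧ l.IsChain G.Adj ∧ ¬ EndsAdj G l := by
  obtain ⟨p, q, L, rfl⟩ : ∃ p q L', L = p :: q :: L' := by
    match L, hL2 with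
    | p :: q :: L, _ => exact ⟨p, q, L, rfl⟩
  obtain ⟨e, s, d, rfl⟩ : ∃ e s d, t = e :: (s ++ [d]) := by
    match t, ht2 with
    | e :: f :: t, _ =>
      exact ⟨e, (f :: t).dropLast, (f :: t).getLast (by simp), by
        rw [List.dropLast_append_getLast]⟩
  have hCr := cycle_chain_reverse_tail hC
  have direct : ∀ t' : List V, t'.Perm (e :: (s ++ [d])) → (c :: (t' ++ [c])).IsChain G.Adj →
      (∀ x ∈ t'.getLast?, ¬ G.Adj p x) →
      ∃ l : List V, l.Perm (p :: q :: L ++ c :: e :: (s ++ [d])) ∧ l.IsChain G.Adj ∧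
        ¬ EndsAdj G l := by
    intro t' hp hch hn
    refine ⟨p :: q :: L ++ c :: t', (hp.cons c).append_left _, ?_, ?_⟩
    · rw [List.isChain_append]
      refine ⟨hL, isChain_of_isSegment hch ⟨[], [c], by simp⟩, ?_⟩
      intro x hx y hy
      simp only [List.head?_cons, Option.mem_some_iff] at hy
      exact hy ▸ hLc x hx
    · rintro ⟨a, ha, b, hb, hab⟩
      simp only [List.cons_append, List.head?_cons, Option.mem_some_iff] at ha
      subst ha
      refine hn b ?_ hab
      have hne : t' ≠ [] := by
        rintro rfl
        simpa using hp.length_eq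
      have : p :: q :: L ++ c :: t' = (p :: q :: L ++ [c]) ++ t' := by simp
      rw [this, List.getLast?_append_of_ne_nil _ hne] at hb
      exact hb
  by_cases hpd : G.Adj p d
  swap
  · exact direct _ (List.Perm.refl _) hC (by
      intro x hx
      rw [show e :: (s ++ [d]) = (e :: s) ++ [d] by simp, List.getLast?_concat,
        Option.mem_some_iff] at hx
      exact hx ▸ hpd)
  by_cases hpe : G.Adj p e
  swap
  · exact direct _ (List.reverse_perm _) hCr (by
      intro x hx
      rw [List.getLast?_reverse, List.head?_cons, Option.mem_some_iff] at hx
      exact hx ▸ hpe)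
  have hLc' : ∀ x ∈ (q :: L).getLast?, G.Adj x c := by
    simpa [List.getLast?_cons_cons] using hLc
  by_cases h1 : ∀ x ∈ (s ++ [d]).head?, ¬ G.Adj q x
  · exact exists_rerouted_path hL hLc' (by simpa using hC) hpe hpd h1
  by_cases h2 : ∀ x ∈ (s.reverse ++ [e]).head?, ¬ G.Adj q x
  · obtain ⟨l, hl, hch, hn⟩ := exists_rerouted_path (d := e) (e := d) (s := s.reverse) hL hLc'
      (by simpa using hCr) hpd hpe h2
    refine ⟨l, hl.trans ?_, hch, hn⟩
    refine List.Perm.append_left _ (List.Perm.cons c ?_)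
    have : d :: (s.reverse ++ [e]) = (e :: (s ++ [d])).reverse := by simp
    exact this ▸ List.reverse_perm _
  exfalso
  push Not at h1 h2
  obtain ⟨x, hx, hqx⟩ := h1
  obtain ⟨y, hy, hqy⟩ := h2
  have hxs : x ∈ s ++ [d] := List.mem_of_mem_head? hx
  have hys : y ∈ s.reverse ++ [e] := List.mem_of_mem_head? hy
  have hxy : x ≠ y := by
    rintro rfl
    rcases s.eq_nil_or_concat with rfl | ⟨s', f, rfl⟩
    · simp only [List.nil_append, List.head?_cons, Option.mem_some_iff, List.reverse_nil] at hx hy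
      subst hx hy
      simp [List.nodup_append] at hnd
    · cases s' with
      | nil => simp [Nat.even_iff] at ht
      | cons g s' =>
        simp only [List.concat_eq_append, List.cons_append, List.head?_cons, Option.mem_some_iff,
          List.reverse_append, List.reverse_cons, List.reverse_nil, List.nil_append] at hx hy
        subst hx hy
        simp [List.nodup_append] at hnd
  obtain ⟨z, hqz, hz⟩ : ∃ z, G.Adj q z ∧ (z ∈ L ∨ z = c) := by
    cases L with
    | nil => exact ⟨c, hLc' q (by simp), Or.inr rfl⟩
    | cons z L =>
      simp only [List.isChain_cons_cons] at hL
      exact ⟨z, hL.2.1, Or.inl (by simp)⟩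
  have hqp : G.Adj q p := by
    simp only [List.isChain_cons_cons] at hL
    exact hL.1.symm
  have hx' : x ∈ e :: (s ++ [d]) := List.mem_cons_of_mem _ hxs
  have hy' : y ∈ e :: (s ++ [d]) := by
    simp only [List.mem_append, List.mem_reverse, List.mem_cons] at hys ⊢
    tauto
  have hpL : ∀ w ∈ c :: e :: (s ++ [d]), p ≠ w ∧ w ∉ L := by
    intro w hw
    rw [List.nodup_append] at hnd
    exact ⟨fun h => hnd.2.2 p (by simp) w hw h,
      fun h => hnd.2.2 w (by simp [h]) w hw rfl⟩
  have hct : ∀ w ∈ e :: (s ++ [d]), c ≠ w := by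
    intro w hw h
    exact (List.nodup_cons.1 (List.nodup_append.1 hnd).2.1).1 (h ▸ hw)
  have hzne : ∀ w ∈ e :: (s ++ [d]), z ≠ w := by
    rintro w hw rfl
    rcases hz with hz | rfl
    · exact (hpL z (List.mem_cons_of_mem _ hw)).2 hz
    · exact hct z hw rfl
  have hpz : p ≠ z := by
    rcases hz with hz | rfl
    · rintro rfl
      simp [hz] at hnd
    · exact (hpL z (by simp)).1
  exact hG.not_four_adj hqp hqz hqx hqy hpz (hpL x (List.mem_cons_of_mem _ hx')).1
    (hpL y (List.mem_cons_of_mem _ hy')).1 (hzne x hx') (hzne y hy') hxy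

theorem cycle_chain_of_isRotated {G : SimpleGraph V} {l l' : List V} (h : l ~r l')
    (hl : Cycle.Chain G.Adj (l : Cycle V)) : Cycle.Chain G.Adj (l' : Cycle V) := by
  rwa [← Cycle.coe_eq_coe.2 h]

theorem exists_isRotated_cons {l : List V} {v : V} (hv : v ∈ l) : ∃ t, l ~r v :: t := by
  obtain ⟨s, t, rfl⟩ := List.append_of_mem hv
  exact ⟨t ++ s, List.isRotated_append⟩

/-- The Hamiltonian path obtained from a cycle by replacing two edges by a chord. -/
theorem isChain_of_chord {G : SimpleGraph V} {x y : V} {A B : List V}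
    (hC : Cycle.Chain G.Adj ((x :: (A ++ y :: B) : List V) : Cycle V)) (hxy : G.Adj x y) :
    (A ++ y :: x :: B.reverse).IsChain G.Adj := by
  rw [Cycle.chain_coe_cons] at hC
  have hAy : (A ++ [y]).IsChain G.Adj := isChain_of_isSegment hC ⟨[x], B ++ [x], by simp⟩
  have hB : (x :: B.reverse).IsChain G.Adj := by
    rw [← isChain_adj_reverse]
    exact isChain_of_isSegment hC ⟨x :: (A ++ [y]), [], by simp⟩
  have : A ++ y :: x :: B.reverse = (A ++ [y]) ++ (x :: B.reverse) := by simp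
  rw [this, List.isChain_append]
  refine ⟨hAy, hB, ?_⟩
  simpa using hxy.symm

/-- If all Hamiltonian paths on the vertices of a cycle have adjacent ends, then every rotation of
a chord of the cycle is a chord again. -/
theorem adj_of_rotate_chord {G : SimpleGraph V} {l : List V}
    (H : ∀ l' : List V, l'.Perm l → l'.IsChain G.Adj → EndsAdj G l') (k : ℕ) :
    ∀ {x y : V} {A B : List V}, Cycle.Chain G.Adj ((x :: (A ++ y :: B) : List V) : Cycle V) →
      (x :: (A ++ y :: B)).Perm l → G.Adj x y → A ≠ [] → B ≠ [] →
      ∀ {x' y' : V} {A' B' : List V}, (x :: (A ++ y :: B)).rotate k = x' :: (A' ++ y' :: B') →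
        A'.length = A.length → G.Adj x' y' := by
  induction k with
  | zero =>
    intro x y A B _ _ hxy _ _ x' y' A' B' heq hlen
    rw [List.rotate_zero, List.cons.injEq] at heq
    obtain ⟨rfl, heq⟩ := heq
    obtain ⟨-, heq⟩ := List.append_inj heq hlen.symm
    obtain ⟨rfl, -⟩ := List.cons.inj heq
    exact hxy
  | succ k ih =>
    intro x y A B hC hp hxy hA hB x' y' A' B' heq hlen
    obtain ⟨a, A, rfl⟩ := List.exists_cons_of_ne_nil hA
    obtain ⟨b, B, rfl⟩ := List.exists_cons_of_ne_nil hB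
    have hrot : (x :: (a :: A ++ y :: b :: B)).rotate 1 =
        a :: ((A ++ [y]) ++ b :: (B ++ [x])) := by simp
    have hab : G.Adj a b := by
      obtain ⟨u, hu, v, hv, huv⟩ := H _ (List.Perm.trans (by
        classical
        rw [List.perm_iff_count]
        intro a
        simp only [List.count_append, List.count_cons, List.count_reverse]
        omega) hp) (isChain_of_chord hC hxy)
      have hbl : (a :: A ++ y :: x :: (b :: B).reverse) =
          (a :: A ++ y :: x :: B.reverse) ++ [b] := by simp
      rw [hbl, List.getLast?_concat, Option.mem_some_iff] at hv
      simp only [List.cons_append, List.head?_cons, Option.mem_some_iff] at hu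
      exact hu ▸ hv ▸ huv
    have hr : (x :: (a :: A ++ y :: b :: B)) ~r a :: ((A ++ [y]) ++ b :: (B ++ [x])) := ⟨1, hrot⟩
    refine ih (cycle_chain_of_isRotated hr hC) (hr.perm.symm.trans hp) hab (by simp) (by simp)
      (B' := B') ?_ (hlen.trans (by simp))
    rw [← hrot, List.rotate_rotate, Nat.add_comm]
    exact heq

/-- An odd cycle with a chord has a Hamiltonian path with non-adjacent ends. -/
theorem exists_path_of_chord [Finite V] {G : SimpleGraph V} (hG : IsCubic G) {x y : V}
    {A B : List V} (hC : Cycle.Chain G.Adj ((x :: (A ++ y :: B) : List V) : Cycle V))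
    (hxy : G.Adj x y) (hA : A ≠ []) (hB : B ≠ []) (hnd : (x :: (A ++ y :: B)).Nodup)
    (hodd : Odd (x :: (A ++ y :: B)).length) :
    ∃ l : List V, l.Perm (x :: (A ++ y :: B)) ∧ l.IsChain G.Adj ∧ ¬ EndsAdj G l := by
  wlog hlt : A.length < B.length generalizing x y A B
  · have hr : (x :: (A ++ y :: B)) ~r (y :: (B ++ x :: A)) :=
      List.isRotated_append (l := x :: A) (l' := y :: B)
    have hBA : B.length < A.length := by
      simp only [List.length_cons, List.length_append, Nat.odd_iff] at hodd
      omega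
    obtain ⟨l, hl, h⟩ := this (cycle_chain_of_isRotated hr hC) hxy.symm hB hA
      (hr.nodup_iff.1 hnd) (hr.perm.length_eq ▸ hodd) hBA
    exact ⟨l, hl.trans hr.perm.symm, h⟩
  by_contra! H
  obtain ⟨A₂, z, B₂, rfl, hlen⟩ : ∃ A₂ z B₂, B = A₂ ++ z :: B₂ ∧ A₂.length = A.length :=
    ⟨B.take A.length, B[A.length], B.drop (A.length + 1), by simp, by simp [hlt.le]⟩
  have hyz : G.Adj y z := by
    refine adj_of_rotate_chord H (A.length + 1) hC (List.Perm.refl _) hxy hA hB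
      (A' := A₂) (B' := B₂ ++ x :: A) ?_ hlen
    rw [show x :: (A ++ y :: (A₂ ++ z :: B₂)) = (x :: A) ++ y :: (A₂ ++ z :: B₂) by simp,
      show A.length + 1 = (x :: A).length by simp, List.rotate_append_length_eq]
    simp
  obtain ⟨b, A₂, rfl⟩ := List.exists_cons_of_ne_nil (l := A₂) (by
    rintro rfl
    exact hA (List.length_eq_zero_iff.1 hlen.symm))
  rcases A.eq_nil_or_concat with rfl | ⟨A, a, rfl⟩
  · exact hA rfl
  rw [Cycle.chain_coe_cons] at hC
  have hay : G.Adj a y := by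
    simpa using isChain_of_isSegment hC (l₁ := [a, y])
      ⟨x :: A, (b :: A₂ ++ z :: B₂) ++ [x], by simp⟩
  have hyb : G.Adj y b := by
    simpa using isChain_of_isSegment hC (l₁ := [y, b])
      ⟨x :: (A ++ [a]), (A₂ ++ z :: B₂) ++ [x], by simp⟩
  refine hG.not_four_adj hxy.symm hay.symm hyb hyz ?_ ?_ ?_ ?_ ?_ ?_ <;>
  · rintro rfl
    simp [List.nodup_append] at hnd

/-- A piece of a factor: a path or a cycle, given by the list of its vertices. -/
inductive Piece (V : Type*)
  | path (l : List V)
  | cycle (l : List V)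

namespace Piece

/-- The vertices of a piece. -/
def verts : Piece V → List V
  | path l => l
  | cycle l => l

/-- The piece is a path on at least two vertices or a cycle of `G`. -/
def Valid (G : SimpleGraph V) : Piece V → Prop
  | path l => l.IsChain G.Adj ∧ 2 ≤ l.length
  | cycle l => Cycle.Chain G.Adj (l : Cycle V) ∧ 3 ≤ l.length

/-- The weight of a piece in the potential that is minimized. -/
noncomputable def cost (G : SimpleGraph V) : Piece V → ℕ
  | path l => if Odd l.length ∧ EndsAdj G l then 5 else 3
  | cycle l => if Odd l.length then 4 else 0

theorem cost_path_le (G : SimpleGraph V) (l : List V) : (path l).cost G ≤ 5 := by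
  simp only [cost]; split_ifs <;> omega

theorem cost_path_of_not {G : SimpleGraph V} {l : List V} (h : ¬ (Odd l.length ∧ EndsAdj G l)) :
    (path l).cost G = 3 := if_neg h

theorem cost_cycle_of_odd {G : SimpleGraph V} {l : List V} (h : Odd l.length) :
    (cycle l).cost G = 4 := if_pos h

end Piece

open Piece

/-- Opening a cycle at one of its vertices. -/
theorem exists_path_of_cycle {G : SimpleGraph V} {l : List V} (hl : (cycle l).Valid G) {v : V}
    (hv : v ∈ l) :
    ∃ L : List V, L.Perm l ∧ L.IsChain G.Adj ∧ L.getLast? = some v := by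
  obtain ⟨t, ht⟩ := exists_isRotated_cons hv
  have hC := (Cycle.chain_coe_cons _ _ _).1 (cycle_chain_of_isRotated ht hl.1)
  exact ⟨t ++ [v], (List.perm_append_singleton v t).trans ht.perm.symm, hC.tail, by simp⟩

/-- A path with adjacent ends can be closed to a cycle. -/
theorem cycle_chain_of_endsAdj {G : SimpleGraph V} {l : List V} (hl : l.IsChain G.Adj)
    (h : EndsAdj G l) :
    Cycle.Chain G.Adj (l : Cycle V) := by
  obtain ⟨a, ha, b, hb, hab⟩ := h
  cases l with
  | nil => simp at ha
  | cons c t =>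
    rw [Cycle.chain_coe_cons, ← List.cons_append, List.isChain_append]
    refine ⟨hl, by simp, ?_⟩
    intro x hx y hy
    simp only [List.head?_cons, Option.mem_some_iff] at ha hy
    obtain rfl : b = x := Option.mem_unique hb hx
    exact hy ▸ ha ▸ hab.symm

/-- The multiset of all vertices of a collection of pieces. -/
def allVerts (𝓕 : Multiset (Piece V)) : Multiset V := 𝓕.bind fun π => (π.verts : Multiset V)

/-- The pieces in `𝓕` are the components of a spanning subgraph of `G`. -/
def IsCover [Fintype V] (G : SimpleGraph V) (𝓕 : Multiset (Piece V)) : Prop :=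
  (∀ π ∈ 𝓕, π.Valid G) ∧ allVerts 𝓕 = (univ : Finset V).val

/-- `𝓕` is a cover of minimum total cost. -/
def IsMinCover [Fintype V] (G : SimpleGraph V) (𝓕 : Multiset (Piece V)) : Prop :=
  IsCover G 𝓕 ∧ ∀ 𝓕', IsCover G 𝓕' → (𝓕.map (cost G)).sum ≤ (𝓕'.map (cost G)).sum

theorem pair_le {𝓕 : Multiset (Piece V)} {π π' : Piece V} (h : π ∈ 𝓕) (h' : π' ∈ 𝓕)
    (hne : π ≠ π') : {π, π'} ≤ 𝓕 := by
  obtain ⟨R, rfl⟩ := Multiset.exists_cons_of_mem h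
  refine Multiset.cons_le_cons _ (Multiset.singleton_le.2 ?_)
  exact (Multiset.mem_cons.1 h').resolve_left hne.symm

section Cover

variable [Fintype V] {G : SimpleGraph V} {𝓕 : Multiset (Piece V)}

theorem IsMinCover.exchange (h : IsMinCover G 𝓕) {A B : Multiset (Piece V)} (hA : A ≤ 𝓕)
    (hB : ∀ π ∈ B, π.Valid G) (hAB : allVerts B = allVerts A) :
    (A.map (cost G)).sum ≤ (B.map (cost G)).sum := by
  obtain ⟨R, rfl⟩ := Multiset.le_iff_exists_add.1 hA
  have hcov : IsCover G (B + R) := by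
    refine ⟨fun π hπ => ?_, ?_⟩
    · rcases Multiset.mem_add.1 hπ with hπ | hπ
      · exact hB π hπ
      · exact h.1.1 π (Multiset.mem_add.2 (Or.inr hπ))
    · have := h.1.2
      rw [allVerts, Multiset.add_bind] at this ⊢
      rw [← this]
      exact congrArg (· + _) hAB
  have := h.2 _ hcov
  simp only [Multiset.map_add, Multiset.sum_add] at this
  omega

theorem IsCover.nodup_pair (h : IsCover G 𝓕) {π π' : Piece V} (hπ : π ∈ 𝓕) (hπ' : π' ∈ 𝓕)
    (hne : π ≠ π') : (π.verts ++ π'.verts).Nodup := by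
  obtain ⟨R, hR⟩ := Multiset.le_iff_exists_add.1 (pair_le hπ hπ' hne)
  have hnd : (allVerts 𝓕).Nodup := h.2 ▸ univ.nodup
  rw [hR, allVerts, Multiset.add_bind] at hnd
  have := (Multiset.nodup_add.1 hnd).1
  simpa using this

theorem IsCover.nodup (h : IsCover G 𝓕) {π : Piece V} (hπ : π ∈ 𝓕) : π.verts.Nodup := by
  obtain ⟨R, rfl⟩ := Multiset.exists_cons_of_mem hπ
  have hnd : (allVerts (π ::ₘ R)).Nodup := h.2 ▸ univ.nodup
  rw [allVerts, Multiset.cons_bind] at hnd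
  simpa using (Multiset.nodup_add.1 hnd).1

theorem IsCover.eq_of_mem (h : IsCover G 𝓕) {π π' : Piece V} (hπ : π ∈ 𝓕) (hπ' : π' ∈ 𝓕) {v : V}
    (hv : v ∈ π.verts) (hv' : v ∈ π'.verts) : π = π' := by
  by_contra hne
  exact (List.nodup_append.1 (h.nodup_pair hπ hπ' hne)).2.2 v hv v hv' rfl

theorem IsCover.exists_mem (h : IsCover G 𝓕) (v : V) : ∃ π ∈ 𝓕, v ∈ π.verts := by
  have hv : v ∈ allVerts 𝓕 := h.2 ▸ mem_univ v
  simpa [allVerts] using hv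

/-- Replacing one piece by another one on the same vertices does not decrease the cost. -/
theorem IsMinCover.cost_le_of_perm (h : IsMinCover G 𝓕) {π π' : Piece V} (hπ : π ∈ 𝓕)
    (hv : π'.Valid G) (hp : π'.verts.Perm π.verts) : π.cost G ≤ π'.cost G := by
  have := h.exchange (A := {π}) (B := {π'}) (Multiset.singleton_le.2 hπ) (by simpa using hv)
    (by simpa [allVerts] using hp)
  simpa using this

/-- Merging two pieces into a single one does not decrease the cost. -/
theorem IsMinCover.cost_le_of_merge (h : IsMinCover G 𝓕) {π₁ π₂ π' : Piece V} (h₁ : π₁ ∈ 𝓕)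
    (h₂ : π₂ ∈ 𝓕) (hne : π₁ ≠ π₂) (hv : π'.Valid G)
    (hp : π'.verts.Perm (π₁.verts ++ π₂.verts)) :
    π₁.cost G + π₂.cost G ≤ π'.cost G := by
  have := h.exchange (A := {π₁, π₂}) (B := {π'}) (pair_le h₁ h₂ hne) (by simpa using hv)
    (by simpa [allVerts] using hp)
  simpa using this

/-- Replacing two pieces by two others on the same vertices does not decrease the cost. -/
theorem IsMinCover.cost_le_of_swap (h : IsMinCover G 𝓕) {π₁ π₂ π₁' π₂' : Piece V} (h₁ : π₁ ∈ 𝓕)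
    (h₂ : π₂ ∈ 𝓕) (hne : π₁ ≠ π₂) (hv₁ : π₁'.Valid G) (hv₂ : π₂'.Valid G)
    (hp : (π₁'.verts ++ π₂'.verts).Perm (π₁.verts ++ π₂.verts)) :
    π₁.cost G + π₂.cost G ≤ π₁'.cost G + π₂'.cost G := by
  have := h.exchange (A := {π₁, π₂}) (B := {π₁', π₂'}) (pair_le h₁ h₂ hne) (by simp [hv₁, hv₂])
    (by simpa [allVerts] using hp)
  simpa using this

/-- An odd cycle can be merged with a disjoint path attached to it. -/
theorem exists_path_of_attached_cycle (hG : IsCubic G) {l L : List V} {v : V}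
    (hl : (cycle l).Valid G) (hodd : Odd l.length) (hv : v ∈ l) (hL : L.IsChain G.Adj)
    (hL2 : 2 ≤ L.length) (hLv : ∀ x ∈ L.getLast?, G.Adj x v) (hnd : (L ++ l).Nodup) :
    ∃ l' : List V, l'.Perm (L ++ l) ∧ l'.IsChain G.Adj ∧ ¬ EndsAdj G l' := by
  obtain ⟨t, ht⟩ := exists_isRotated_cons hv
  have hC := cycle_chain_of_isRotated ht hl.1
  have hp : (L ++ v :: t).Perm (L ++ l) := ht.perm.symm.append_left L
  have hlen := ht.perm.length_eq
  have h3 := hl.2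
  rw [List.length_cons] at hlen
  rw [hlen] at hodd h3
  obtain ⟨l', hl', h⟩ := exists_merged_path hG hL hL2 hLv ((Cycle.chain_coe_cons _ _ _).1 hC)
    (by rw [Nat.odd_add_one, Nat.not_odd_iff_even] at hodd; exact hodd) (by omega)
    (hp.nodup_iff.2 hnd)
  exact ⟨l', hl'.trans hp, h⟩

theorem IsMinCover.not_endsAdj_of_odd (h : IsMinCover G 𝓕) {l : List V} (hl : path l ∈ 𝓕) :
    ¬ (Odd l.length ∧ EndsAdj G l) := by
  rintro ⟨hodd, hadj⟩
  have hv := h.1.1 _ hl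
  have h3 : 3 ≤ l.length := by
    have := hv.2
    rw [Nat.odd_iff] at hodd
    omega
  have hle := h.cost_le_of_perm hl (π' := cycle l) ⟨cycle_chain_of_endsAdj hv.1 hadj, h3⟩
    (List.Perm.refl _)
  rw [cost_cycle_of_odd hodd] at hle
  simp only [cost, hodd, hadj, and_self, if_true] at hle
  omega

theorem IsMinCover.cost_path (h : IsMinCover G 𝓕) {l : List V} (hl : path l ∈ 𝓕) :
    (path l).cost G = 3 :=
  cost_path_of_not (h.not_endsAdj_of_odd hl)

theorem IsMinCover.not_adj_of_paths (h : IsMinCover G 𝓕) {P Q l m : List V} (hP : path P ∈ 𝓕)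
    (hQ : path Q ∈ 𝓕) (hne : path P ≠ path Q) (hl : l.Perm P) (hm : m.Perm Q)
    (hlc : l.IsChain G.Adj) (hmc : m.IsChain G.Adj) {u v : V} (hu : u ∈ l.getLast?)
    (hv : v ∈ m.head?) : ¬ G.Adj u v := by
  intro huv
  have hch : (l ++ m).IsChain G.Adj := by
    rw [List.isChain_append]
    refine ⟨hlc, hmc, fun x hx y hy => ?_⟩
    rwa [Option.mem_unique hx hu, Option.mem_unique hy hv]
  have hlen : 2 ≤ (l ++ m).length := by
    have h2 := (h.1.1 _ hP).2
    rw [List.length_append, hl.length_eq]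
    omega
  have hle := h.cost_le_of_merge hP hQ hne (π' := path (l ++ m)) ⟨hch, hlen⟩ (hl.append hm)
  have h5 := cost_path_le G (l ++ m)
  rw [h.cost_path hP, h.cost_path hQ] at hle
  omega

theorem IsMinCover.not_chord (h : IsMinCover G 𝓕) (hG : IsCubic G) {l : List V}
    (hl : cycle l ∈ 𝓕) (hodd : Odd l.length) {x y : V} {A B : List V}
    (hr : l ~r x :: (A ++ y :: B)) (hA : A ≠ []) (hB : B ≠ []) : ¬ G.Adj x y := by
  intro hxy
  obtain ⟨hC, h3⟩ := h.1.1 _ hl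
  obtain ⟨l', hp, hch, hn⟩ := exists_path_of_chord hG (cycle_chain_of_isRotated hr hC) hxy hA hB
    (hr.nodup_iff.1 (h.1.nodup hl)) (hr.perm.length_eq ▸ hodd)
  have hp' := hp.trans hr.perm.symm
  have hle := h.cost_le_of_perm hl (π' := path l') ⟨hch, by rw [hp'.length_eq]; omega⟩ hp'
  rw [cost_cycle_of_odd hodd, cost_path_of_not fun h => hn h.2] at hle
  omega

theorem IsMinCover.not_adj_of_cycles (h : IsMinCover G 𝓕) (hG : IsCubic G) {l m : List V}
    (hl : cycle l ∈ 𝓕) (hodd : Odd l.length) (hm : cycle m ∈ 𝓕) (hne : cycle m ≠ cycle l)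
    {v x : V} (hv : v ∈ l) (hx : x ∈ m) : ¬ G.Adj v x := by
  intro hvx
  obtain ⟨L, hLp, hLc, hLx⟩ := exists_path_of_cycle (h.1.1 _ hm) hx
  have h3 := (h.1.1 _ hm).2
  obtain ⟨l', hp, hch, hn⟩ := exists_path_of_attached_cycle hG (h.1.1 _ hl) hodd hv hLc
    (by rw [hLp.length_eq]; omega) (by simpa [hLx] using hvx.symm)
    ((hLp.append_right l).nodup_iff.2 (h.1.nodup_pair hm hl hne))
  have hp' := hp.trans (hLp.append_right l)
  have hle := h.cost_le_of_merge hm hl hne (π' := path l')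
    ⟨hch, by rw [hp'.length_eq, List.length_append]; omega⟩ hp'
  rw [cost_cycle_of_odd hodd, cost_path_of_not fun h => hn h.2] at hle
  omega

/-- The part of a path behind a vertex attached to an odd cycle is not empty, and it is either a
single vertex or odd with adjacent ends. -/
theorem IsMinCover.odd_endsAdj_of_adj_cycle (h : IsMinCover G 𝓕) (hG : IsCubic G) {l P : List V}
    (hl : cycle l ∈ 𝓕) (hodd : Odd l.length) (hP : path P ∈ 𝓕) {A B : List V} {v x : V}
    (hv : v ∈ l) (hxv : G.Adj x v) (hp : (A ++ x :: B).Perm P)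
    (hch : (A ++ x :: B).IsChain G.Adj) (hA : A ≠ []) :
    B.length = 1 ∨ 3 ≤ B.length ∧ Odd B.length ∧ EndsAdj G B := by
  have hApos := List.length_pos_iff.2 hA
  have hne : path P ≠ cycle l := by simp
  have hsplit : A ++ x :: B = (A ++ [x]) ++ B := by simp
  have hnd : ((A ++ [x]) ++ B ++ l).Nodup := by
    rw [← hsplit]
    exact (hp.append_right l).nodup_iff.2 (h.1.nodup_pair hP hl hne)
  obtain ⟨l', hp', hch', hn⟩ := exists_path_of_attached_cycle hG (h.1.1 _ hl) hodd hv
    (L := A ++ [x]) (isChain_of_isSegment hch ⟨[], B, by simp⟩) (by simp; omega)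
    (by simpa using hxv)
    (hnd.sublist (by simp))
  have hlen : 2 ≤ l'.length := by
    rw [hp'.length_eq]
    simp only [List.length_append, List.length_cons, List.length_nil]
    omega
  have hperm : (l' ++ B).Perm (P ++ l) := by
    refine (hp'.append_right B).trans (List.Perm.trans ?_ (hp.append_right l))
    rw [hsplit, List.append_assoc, List.append_assoc (A ++ [x])]
    exact List.perm_append_comm.append_left _
  have hP3 := h.cost_path hP
  have hl4 := cost_cycle_of_odd (G := G) hodd
  have hl'3 := cost_path_of_not (G := G) (l := l') fun h => hn h.2
  rcases Nat.lt_or_ge B.length 2 with hB | hB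
  · refine Or.inl ?_
    by_contra hB1
    obtain rfl : B = [] := List.length_eq_zero_iff.1 (by omega)
    have hle := h.cost_le_of_merge hP hl hne (π' := path l') ⟨hch', hlen⟩
      (by simpa [verts] using hperm)
    omega
  · refine Or.inr ?_
    have key : Odd B.length ∧ EndsAdj G B := by
      by_contra hBn
      have hle := h.cost_le_of_swap hP hl hne (π₁' := path l') (π₂' := path B) ⟨hch', hlen⟩
        ⟨isChain_of_isSegment hch ⟨A ++ [x], [], by simp⟩, hB⟩ hperm
      rw [cost_path_of_not hBn] at hle
      omega
    have := key.1
    rw [Nat.odd_iff] at this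
    exact ⟨by omega, key⟩

/-- A vertex of a path attached to an odd cycle splits the path into two odd parts. -/
theorem IsMinCover.odd_parts_of_adj_cycle (h : IsMinCover G 𝓕) (hG : IsCubic G) {l : List V}
    (hl : cycle l ∈ 𝓕) (hodd : Odd l.length) {A B : List V} {v x : V}
    (hP : path (A ++ x :: B) ∈ 𝓕) (hv : v ∈ l) (hxv : G.Adj x v) :
    Odd A.length ∧ Odd B.length := by
  have hval := h.1.1 _ hP
  have hrev : (B.reverse ++ x :: A.reverse) = (A ++ x :: B).reverse := by simp
  have hB : A ≠ [] → Odd B.length := fun hA => by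
    rcases h.odd_endsAdj_of_adj_cycle hG hl hodd hP hv hxv (List.Perm.refl _) hval.1 hA with
      h1 | ⟨-, h1, -⟩
    · exact h1 ▸ odd_one
    · exact h1
  have hA : B ≠ [] → Odd A.length := fun hB => by
    have := h.odd_endsAdj_of_adj_cycle hG hl hodd hP (A := B.reverse) (B := A.reverse) hv hxv
      (hrev ▸ List.reverse_perm _) (hrev ▸ isChain_adj_reverse.2 hval.1) (by simpa using hB)
    rw [List.length_reverse] at this
    rcases this with h1 | ⟨-, h1, -⟩
    · exact h1 ▸ odd_one
    · exact h1
  by_cases hA0 : A = []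
  · subst hA0
    have hB0 : B ≠ [] := by
      rintro rfl
      simpa using hval.2
    simpa using hA hB0
  · refine ⟨hA ?_, hB hA0⟩
    rintro rfl
    simpa using hB hA0

/-- Two different vertices of a path are not both attached to odd cycles. -/
theorem IsMinCover.not_two_attached (h : IsMinCover G 𝓕) (hG : IsCubic G) {l m : List V}
    (hl : cycle l ∈ 𝓕) (hodd : Odd l.length) (hm : cycle m ∈ 𝓕) (hmodd : Odd m.length)
    {A M B : List V} {v w x y : V} (hP : path (A ++ x :: (M ++ y :: B)) ∈ 𝓕)
    (hv : v ∈ l) (hxv : G.Adj x v) (hw : w ∈ m) (hyw : G.Adj y w) : False := by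
  have hval := h.1.1 _ hP
  obtain ⟨hAodd, -⟩ := h.odd_parts_of_adj_cycle hG hl hodd hP hv hxv
  have hA : A ≠ [] := by
    rintro rfl
    simp at hAodd
  obtain ⟨-, hBodd⟩ := h.odd_parts_of_adj_cycle hG hm hmodd (A := A ++ x :: M) (B := B)
    (by simpa using hP) hw hyw
  have hBpos := hBodd.pos
  have hApos := hAodd.pos
  obtain ⟨h3, -, hends⟩ := (h.odd_endsAdj_of_adj_cycle hG hl hodd hP hv hxv (List.Perm.refl _)
    hval.1 hA).resolve_left (by
      simp only [List.length_append, List.length_cons]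
      omega)
  have hD : (cycle (M ++ y :: B)).Valid G :=
    ⟨cycle_chain_of_endsAdj (isChain_of_isSegment hval.1 ⟨A ++ [x], [], by simp⟩) hends, h3⟩
  obtain ⟨L, hLp, hLc, hLy⟩ := exists_path_of_cycle hD (v := y) (by simp)
  have hne : path (A ++ x :: (M ++ y :: B)) ≠ cycle m := by simp
  have hnd := h.1.nodup_pair hP hm hne
  have hLm := hLp.append_right m
  obtain ⟨l', hp', hch', hn⟩ := exists_path_of_attached_cycle hG (h.1.1 _ hm) hmodd hw hLc
    (by rw [hLp.length_eq]; omega) (by simpa [hLy] using hyw)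
    (hLm.nodup_iff.2 (hnd.sublist (by simp [verts])))
  have hperm : ((A ++ [x]) ++ l').Perm (A ++ x :: (M ++ y :: B) ++ m) := by
    have : A ++ x :: (M ++ y :: B) ++ m = (A ++ [x]) ++ (M ++ y :: B ++ m) := by simp
    rw [this]
    exact (hp'.trans hLm).append_left _
  have hle := h.cost_le_of_swap hP hm hne (π₁' := path (A ++ [x])) (π₂' := path l')
    ⟨isChain_of_isSegment hval.1 ⟨[], M ++ y :: B, by simp⟩, by simp; omega⟩
    ⟨hch', by rw [(hp'.trans hLm).length_eq, List.length_append]; omega⟩ hperm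
  rw [h.cost_path hP, cost_cycle_of_odd hmodd, cost_path_of_not fun h => hn h.2,
    cost_path_of_not] at hle
  · omega
  · rintro ⟨h1, -⟩
    rw [List.length_append, List.length_singleton, Nat.odd_add_one] at h1
    exact h1 hAodd

/-- By Hall's theorem a cubic graph has a permutation moving each vertex to a neighbour. -/
theorem IsCubic.exists_perm_adj (hG : IsCubic G) : ∃ σ : Equiv.Perm V, ∀ v, G.Adj v (σ v) := by
  have hdeg : ∀ v, #(G.neighborFinset v) = 3 := fun v => by
    rw [← hG v, ← Set.ncard_coe_finset, SimpleGraph.coe_neighborFinset]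
  obtain ⟨f, hf, hadj⟩ := (Finset.all_card_le_biUnion_card_iff_exists_injective
    fun v => G.neighborFinset v).1 fun s => by
      have hle := Finset.card_mul_le_card_mul (s := s) (t := s.biUnion fun v => G.neighborFinset v)
        (m := 3) (n := 3) G.Adj
        (fun a ha => by
          rw [← hdeg a]
          refine card_le_card fun b hb => ?_
          rw [SimpleGraph.mem_neighborFinset] at hb
          exact mem_filter.2 ⟨mem_biUnion.2 ⟨a, ha, by simpa using hb⟩, hb⟩)
        (fun b _ => by
          rw [← hdeg b]
          refine card_le_card fun a ha => ?_
          rw [SimpleGraph.mem_neighborFinset]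
          exact (mem_filter.1 ha).2.symm)
      omega
  exact ⟨Equiv.ofBijective f (Finite.injective_iff_bijective.1 hf), fun v => by
    simpa using hadj v⟩

/-- The orbit of a vertex under a permutation moving each vertex to a neighbour is a piece. -/
theorem exists_piece_of_perm {σ : Equiv.Perm V} (hσ : ∀ v, G.Adj v (σ v)) (x : V) :
    ∃ π : Piece V, π.Valid G ∧ (π.verts : Multiset V) = (σ.cycleOf x).support.val := by
  have hx : x ∈ σ.support := Equiv.Perm.mem_support.2 (hσ x).ne'
  have h2 := Equiv.Perm.two_le_length_toList_iff_mem_support.2 hx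
  have hch : (σ.toList x).IsChain G.Adj := by
    rw [List.isChain_iff_getElem]
    intro i hi
    rw [Equiv.Perm.getElem_toList, Equiv.Perm.getElem_toList, pow_succ', Equiv.Perm.mul_apply]
    exact hσ _
  have hverts : (σ.toList x : Multiset V) = (σ.cycleOf x).support.val := by
    refine (Multiset.Nodup.ext (Multiset.coe_nodup.2 (Equiv.Perm.nodup_toList σ x))
      (nodup _)).2 fun y => ?_
    rw [Multiset.mem_coe, Equiv.Perm.mem_toList_iff, mem_val,
      Equiv.Perm.mem_support_cycleOf_iff]
  rcases Nat.lt_or_ge (σ.toList x).length 3 with h3 | h3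
  · exact ⟨path (σ.toList x), ⟨hch, h2⟩, hverts⟩
  · refine ⟨cycle (σ.toList x), ⟨cycle_chain_of_endsAdj hch ?_, h3⟩, hverts⟩
    refine ⟨x, ?_, (σ.toList x)[(σ.toList x).length - 1], ?_, ?_⟩
    · rw [List.head?_eq_getElem?, List.getElem?_eq_getElem (by omega)]
      simp [Equiv.Perm.getElem_toList]
    · rw [List.getLast?_eq_getElem?, List.getElem?_eq_getElem (by omega)]
      rfl
    · rw [Equiv.Perm.getElem_toList]
      refine SimpleGraph.Adj.symm ?_
      convert hσ _ using 1
      rw [← Equiv.Perm.mul_apply, ← pow_succ', Nat.sub_add_cancel (by omega),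
        Equiv.Perm.length_toList]
      have hmod :=
        Equiv.Perm.pow_mod_card_support_cycleOf_self_apply σ #(σ.cycleOf x).support x
      rwa [Nat.mod_self, pow_zero, Equiv.Perm.one_apply] at hmod

theorem IsCubic.exists_isCover (hG : IsCubic G) : ∃ 𝓕, IsCover G 𝓕 := by
  obtain ⟨σ, hσ⟩ := hG.exists_perm_adj
  have hpiece : ∀ c : Equiv.Perm V, ∃ π : Piece V, c ∈ σ.cycleFactorsFinset →
      π.Valid G ∧ (π.verts : Multiset V) = c.support.val := by
    intro c
    by_cases hc : c ∈ σ.cycleFactorsFinset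
    · obtain ⟨x, hx⟩ := (Equiv.Perm.mem_cycleFactorsFinset_iff.1 hc).1.nonempty_support
      obtain ⟨π, hπ⟩ := exists_piece_of_perm hσ x
      rw [← Equiv.Perm.cycle_is_cycleOf hx hc] at hπ
      exact ⟨π, fun _ => hπ⟩
    · exact ⟨path [], fun h => absurd h hc⟩
  choose g hg using hpiece
  refine ⟨σ.cycleFactorsFinset.val.map g, fun π hπ => ?_, ?_⟩
  · obtain ⟨c, hc, rfl⟩ := Multiset.mem_map.1 hπ
    exact (hg c hc).1
  · have hdisj : (σ.cycleFactorsFinset : Set (Equiv.Perm V)).PairwiseDisjoint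
        Equiv.Perm.support := fun c hc d hd hcd =>
      (Equiv.Perm.cycleFactorsFinset_pairwise_disjoint σ hc hd hcd).disjoint_support
    have huniv : (univ : Finset V) = σ.cycleFactorsFinset.disjiUnion Equiv.Perm.support hdisj := by
      ext x
      simp only [mem_univ, mem_disjiUnion, true_iff]
      have hx : x ∈ σ.support := Equiv.Perm.mem_support.2 (hσ x).ne'
      exact ⟨σ.cycleOf x, Equiv.Perm.cycleOf_mem_cycleFactorsFinset_iff.2 hx,
        Equiv.Perm.mem_support_cycleOf_iff.2 ⟨Equiv.Perm.SameCycle.refl _ _, hx⟩⟩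
    rw [huniv, allVerts, Multiset.bind_map, disjiUnion_val]
    exact Multiset.bind_congr fun c hc => (hg c hc).2

theorem IsCubic.exists_isMinCover (hG : IsCubic G) : ∃ 𝓕, IsMinCover G 𝓕 := by
  obtain ⟨𝓕, h𝓕⟩ := hG.exists_isCover
  obtain ⟨𝓜, h𝓜, hmin⟩ := exists_minimalFor_of_wellFoundedLT (IsCover G)
    (fun 𝓕 => (𝓕.map (cost G)).sum) ⟨𝓕, h𝓕⟩
  exact ⟨𝓜, h𝓜, fun 𝓕' h' => (le_total _ _).elim id (hmin h')⟩

end Cover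

theorem cons_eq_of_isRotated {v : V} {t t' : List V} (h : (v :: t) ~r (v :: t'))
    (hnd : (v :: t).Nodup) : t = t' := by
  obtain ⟨n, hn, h⟩ := List.isRotated_iff_mod.1 h
  rw [List.rotate_eq_drop_append_take hn] at h
  obtain ⟨p, q, hpq, hqp⟩ : ∃ p q, v :: t = p ++ q ∧ q ++ p = v :: t' :=
    ⟨_, _, (List.take_append_drop n _).symm, h⟩
  cases p with
  | nil => simp_all
  | cons a p =>
    cases q with
    | nil => simp_all
    | cons b q =>
      simp only [List.cons_append, List.cons.injEq] at hpq hqp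
      obtain ⟨⟨rfl, rfl⟩, rfl, -⟩ := And.intro hpq hqp
      simp at hnd

theorem append_cons_inj_of_nodup {v : V} {s t s' t' : List V} (hnd : (s ++ v :: t).Nodup)
    (h : s ++ v :: t = s' ++ v :: t') : s = s' ∧ t = t' := by
  induction s generalizing s' with
  | nil =>
    cases s' with
    | nil => simpa using h
    | cons a s' =>
      simp only [List.nil_append, List.cons_append, List.cons.injEq] at h
      simp [h.2] at hnd
  | cons b s ih =>
    cases s' with
    | nil =>
      simp only [List.nil_append, List.cons_append, List.cons.injEq] at h
      simp [h.1] at hnd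
    | cons a s' =>
      simp only [List.cons_append, List.cons.injEq] at h
      obtain ⟨rfl, h⟩ := h
      obtain ⟨rfl, rfl⟩ := ih (List.nodup_cons.1 hnd).2 h
      exact ⟨rfl, rfl⟩

/-- `v` directly follows `u` on the piece. -/
def Piece.Next : Piece V → V → V → Prop
  | path l, u, v => [u, v] <:+: l
  | cycle l, u, v => ∃ t, l ~r u :: v :: t

theorem next_path_iff {s t : List V} {u v : V} (hnd : (s ++ v :: t).Nodup) :
    (path (s ++ v :: t)).Next v u ↔ u ∈ t.head? := by
  constructor
  · rintro ⟨a, b, h⟩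
    obtain ⟨-, rfl⟩ := append_cons_inj_of_nodup (s' := a) (t' := u :: b) hnd (by simpa using h.symm)
    simp
  · intro h
    obtain ⟨t', rfl⟩ := List.head?_eq_some_iff.1 h
    exact ⟨s, t', by simp⟩

theorem next_path_iff' {s t : List V} {u v : V} (hnd : (s ++ v :: t).Nodup) :
    (path (s ++ v :: t)).Next u v ↔ u ∈ s.getLast? := by
  constructor
  · rintro ⟨a, b, h⟩
    obtain ⟨rfl, -⟩ := append_cons_inj_of_nodup (s' := a ++ [u]) (t' := b) hnd
      (by simpa using h.symm)
    simp
  · intro h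
    obtain ⟨s', rfl⟩ := List.getLast?_eq_some_iff.1 h
    exact ⟨s', t, by simp⟩

theorem next_cycle_iff {l t : List V} {u v : V} (hnd : l.Nodup) (hr : l ~r v :: t) :
    (cycle l).Next v u ↔ u ∈ t.head? := by
  constructor
  · rintro ⟨t', h⟩
    obtain rfl := cons_eq_of_isRotated (hr.symm.trans h) (hr.nodup_iff.1 hnd)
    simp
  · intro h
    obtain ⟨t', rfl⟩ := List.head?_eq_some_iff.1 h
    exact ⟨t', hr⟩

theorem next_cycle_iff' {l t : List V} {u v : V} (hnd : l.Nodup) (hr : l ~r v :: t) :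
    (cycle l).Next u v ↔ u ∈ t.getLast? := by
  constructor
  · rintro ⟨t', h⟩
    have h' : l ~r v :: (t' ++ [u]) := h.trans (List.isRotated_append (l := [u]) (l' := v :: t'))
    obtain rfl := cons_eq_of_isRotated (hr.symm.trans h') (hr.nodup_iff.1 hnd)
    simp
  · intro h
    obtain ⟨t', rfl⟩ := List.getLast?_eq_some_iff.1 h
    exact ⟨t', hr.trans (List.isRotated_append (l := v :: t') (l' := [u]))⟩

theorem Piece.Next.mem {π : Piece V} {u v : V} (h : π.Next u v) : u ∈ π.verts ∧ v ∈ π.verts := by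
  cases π with
  | path l => exact ⟨h.subset (by simp), h.subset (by simp)⟩
  | cycle l =>
    obtain ⟨t, ht⟩ := h
    exact ⟨ht.mem_iff.2 (by simp), ht.mem_iff.2 (by simp)⟩

theorem Piece.Next.adj {G : SimpleGraph V} {π : Piece V} (hπ : π.Valid G) {u v : V}
    (h : π.Next u v) : G.Adj u v := by
  cases π with
  | path l => simpa using isChain_of_isSegment hπ.1 h
  | cycle l =>
    obtain ⟨t, ht⟩ := h
    have hC := cycle_chain_of_isRotated ht hπ.1
    rw [Cycle.chain_coe_cons, List.cons_append, List.isChain_cons_cons] at hC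
    exact hC.1

/-- The spanning subgraph with the given pieces. -/
def factor (𝓕 : Multiset (Piece V)) : SimpleGraph V :=
  SimpleGraph.fromRel fun u v => ∃ π ∈ 𝓕, π.Next u v

theorem reachable_of_isChain {F : SimpleGraph V} {l : List V} (hl : l.IsChain F.Adj) {u v : V}
    (hu : u ∈ l) (hv : v ∈ l) : F.Reachable u v := by
  induction l generalizing u v with
  | nil => simp at hu
  | cons a t ih =>
    have hhead : ∀ w ∈ a :: t, F.Reachable a w := by
      intro w hw
      rcases List.mem_cons.1 hw with rfl | hw
      · exact SimpleGraph.Reachable.refl _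
      · obtain ⟨b, t, rfl⟩ := List.exists_cons_of_ne_nil (List.ne_nil_of_mem hw)
        have hab := (List.isChain_cons_cons.1 hl).1
        exact hab.reachable.trans (ih hl.tail (by simp) hw)
    exact (hhead u hu).symm.trans (hhead v hv)

section Factor

variable [Fintype V] {G : SimpleGraph V} {𝓕 : Multiset (Piece V)}

theorem IsCover.factor_le (h : IsCover G 𝓕) : factor 𝓕 ≤ G := by
  intro u v huv
  rcases huv.2 with ⟨π, hπ, hn⟩ | ⟨π, hπ, hn⟩
  · exact hn.adj (h.1 π hπ)
  · exact (hn.adj (h.1 π hπ)).symm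

theorem IsCover.factor_adj_iff (h : IsCover G 𝓕) {π : Piece V} (hπ : π ∈ 𝓕) {u v : V}
    (hu : u ∈ π.verts) : (factor 𝓕).Adj u v ↔ π.Next u v ∨ π.Next v u := by
  constructor
  · rintro ⟨-, ⟨π', hπ', hn⟩ | ⟨π', hπ', hn⟩⟩
    · exact Or.inl (h.eq_of_mem hπ hπ' hu hn.mem.1 ▸ hn)
    · exact Or.inr (h.eq_of_mem hπ hπ' hu hn.mem.2 ▸ hn)
  · rintro (hn | hn)
    · exact ⟨(hn.adj (h.1 π hπ)).ne, Or.inl ⟨π, hπ, hn⟩⟩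
    · exact ⟨(hn.adj (h.1 π hπ)).ne', Or.inr ⟨π, hπ, hn⟩⟩

theorem IsCover.reachable_iff (h : IsCover G 𝓕) {π : Piece V} (hπ : π ∈ 𝓕) {u v : V}
    (hu : u ∈ π.verts) : (factor 𝓕).Reachable u v ↔ v ∈ π.verts := by
  constructor
  · rintro ⟨p⟩
    induction p with
    | nil => exact hu
    | cons hadj _ ih =>
      refine ih ?_
      rcases (h.factor_adj_iff hπ hu).1 hadj with hn | hn
      · exact hn.mem.2
      · exact hn.mem.1
  · intro hv
    refine reachable_of_isChain (l := π.verts) ?_ hu hv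
    have hadj : ∀ a b, π.Next a b → (factor 𝓕).Adj a b := fun a b hn =>
      (h.factor_adj_iff hπ hn.mem.1).2 (Or.inl hn)
    refine (List.isChain_isInfix π.verts).imp fun a b hab => hadj a b ?_
    cases π with
    | path l => exact hab
    | cycle l =>
      obtain ⟨s, t, hst⟩ := hab
      refine ⟨t ++ s, ?_⟩
      have : l = s ++ a :: b :: t := by
        rw [show l = (cycle l).verts from rfl, ← hst]
        simp
      rw [this]
      exact List.isRotated_append

theorem IsCover.ncard_supp (h : IsCover G 𝓕) {π : Piece V} (hπ : π ∈ 𝓕) {u : V}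
    (hu : u ∈ π.verts) : ((factor 𝓕).connectedComponentMk u).supp.ncard = π.verts.length := by
  have hsupp : ((factor 𝓕).connectedComponentMk u).supp = (π.verts.toFinset : Set V) := by
    ext v
    rw [SimpleGraph.ConnectedComponent.mem_supp_iff, SimpleGraph.ConnectedComponent.eq,
      SimpleGraph.reachable_comm, h.reachable_iff hπ hu]
    simp
  rw [hsupp, Set.ncard_coe_finset, List.toFinset_card_of_nodup (h.nodup hπ)]

theorem IsCover.neighborSet_path (h : IsCover G 𝓕) {s t : List V} {v : V}
    (hπ : path (s ++ v :: t) ∈ 𝓕) :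
    (factor 𝓕).neighborSet v = {u | u ∈ s.getLast? ∨ u ∈ t.head?} := by
  ext u
  have hnd := h.nodup hπ
  rw [SimpleGraph.mem_neighborSet, h.factor_adj_iff hπ (by simp [verts]), next_path_iff hnd,
    next_path_iff' hnd, or_comm]
  rfl

theorem IsCover.neighborSet_cycle (h : IsCover G 𝓕) {l t : List V} {v : V}
    (hπ : cycle l ∈ 𝓕) (hr : l ~r v :: t) :
    (factor 𝓕).neighborSet v = {u | u ∈ t.head? ∨ u ∈ t.getLast?} := by
  ext u
  have hnd := h.nodup hπ
  rw [SimpleGraph.mem_neighborSet, h.factor_adj_iff hπ (hr.mem_iff.2 (by simp)),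
    next_cycle_iff (l := l) hnd hr, next_cycle_iff' (l := l) hnd hr]
  rfl

theorem IsCover.ncard_neighborSet_cycle (h : IsCover G 𝓕) {l : List V} {v : V}
    (hπ : cycle l ∈ 𝓕) (hv : v ∈ l) : ((factor 𝓕).neighborSet v).ncard = 2 := by
  obtain ⟨t, hr⟩ := exists_isRotated_cons hv
  have h3 := (h.1 _ hπ).2
  have hnd := hr.nodup_iff.1 (h.nodup hπ)
  rw [h.neighborSet_cycle hπ hr]
  rw [hr.perm.length_eq] at h3
  obtain ⟨a, s, b, rfl⟩ : ∃ a s b, t = a :: (s ++ [b]) := by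
    match t, h3 with
    | a :: c :: t, _ =>
      exact ⟨a, (c :: t).dropLast, (c :: t).getLast (by simp), by
        rw [List.dropLast_append_getLast]⟩
  have hab : a ≠ b := by
    rintro rfl
    simp at hnd
  have hset : {u | u ∈ (a :: (s ++ [b])).head? ∨ u ∈ (a :: (s ++ [b])).getLast?} = {a, b} := by
    ext u
    rw [← List.cons_append, List.getLast?_concat]
    simp [eq_comm]
  rw [hset, Set.ncard_pair hab]

theorem IsCover.ncard_neighborSet_path (h : IsCover G 𝓕) {s t : List V} {v : V}
    (hπ : path (s ++ v :: t) ∈ 𝓕) :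
    ((factor 𝓕).neighborSet v).ncard = if s = [] ∨ t = [] then 1 else 2 := by
  have h2 := (h.1 _ hπ).2
  have hnd := h.nodup hπ
  rw [h.neighborSet_path hπ]
  rcases s.eq_nil_or_concat with rfl | ⟨s, a, rfl⟩
  · cases t with
    | nil => simp at h2
    | cons b t => simp
  · cases t with
    | nil => simp
    | cons b t =>
      have hab : a ≠ b := by
        rintro rfl
        simp [verts, List.nodup_append] at hnd
      have hset : {u | u ∈ (s ++ [a]).getLast? ∨ u ∈ (b :: t).head?} = {a, b} := by
        ext u
        simp [eq_comm]
      simp only [List.concat_eq_append, hset, Set.ncard_pair hab]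
      simp

theorem IsCover.exists_path_of_isPathEnd (h : IsCover G 𝓕) {v : V}
    (hv : IsPathEnd (factor 𝓕) v) :
    ∃ l, path l ∈ 𝓕 ∧ v ∈ l ∧ (v ∈ l.head? ∨ v ∈ l.getLast?) := by
  unfold IsPathEnd at hv
  obtain ⟨π, hπ, hvπ⟩ := h.exists_mem v
  cases π with
  | cycle l =>
    rw [h.ncard_neighborSet_cycle hπ hvπ] at hv
    omega
  | path l =>
    obtain ⟨s, t, rfl⟩ := List.append_of_mem (show v ∈ l from hvπ)
    refine ⟨_, hπ, hvπ, ?_⟩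
    rw [h.ncard_neighborSet_path hπ] at hv
    split_ifs at hv with hst
    · rcases hst with rfl | rfl <;> simp
    · omega

theorem IsCover.exists_end_of_path (h : IsCover G 𝓕) {l : List V} (hl : path l ∈ 𝓕) :
    ∃ u ∈ l, ((factor 𝓕).neighborSet u).ncard = 1 := by
  have h2 := (h.1 _ hl).2
  match l, h2 with
  | a :: t, _ =>
    exact ⟨a, by simp, by rw [h.ncard_neighborSet_path (s := []) (t := t) hl]; simp⟩

theorem IsCover.exists_cycle_of_inOddCycle (h : IsCover G 𝓕) {v : V}
    (hv : InOddCycle (factor 𝓕) v) : ∃ l, cycle l ∈ 𝓕 ∧ Odd l.length ∧ v ∈ l := by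
  obtain ⟨π, hπ, hvπ⟩ := h.exists_mem v
  obtain ⟨hdeg, hodd⟩ := hv
  rw [h.ncard_supp hπ hvπ] at hodd
  cases π with
  | cycle l => exact ⟨l, hπ, hodd, hvπ⟩
  | path l =>
    obtain ⟨u, hu, hu1⟩ := h.exists_end_of_path hπ
    have := hdeg u ((h.reachable_iff hπ hvπ).2 hu)
    omega

theorem IsCover.exists_path_of_inOddPath (h : IsCover G 𝓕) {v : V}
    (hv : InOddPath (factor 𝓕) v) : ∃ l, path l ∈ 𝓕 ∧ v ∈ l := by
  obtain ⟨π, hπ, hvπ⟩ := h.exists_mem v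
  obtain ⟨⟨u, hvu, hu⟩, -⟩ := hv
  cases π with
  | path l => exact ⟨l, hπ, hvπ⟩
  | cycle l =>
    rw [h.ncard_neighborSet_cycle hπ ((h.reachable_iff hπ hvπ).1 hvu)] at hu
    omega

theorem IsCover.exists_perm_getLast (h : IsCover G 𝓕) {l : List V} {v : V} (hl : path l ∈ 𝓕)
    (hv : v ∈ l.head? ∨ v ∈ l.getLast?) :
    ∃ l' : List V, l'.Perm l ∧ l'.IsChain G.Adj ∧ v ∈ l'.getLast? := by
  have hch := (h.1 _ hl).1
  rcases hv with hv | hv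
  · exact ⟨l.reverse, List.reverse_perm l, isChain_adj_reverse.2 hch, by simpa using hv⟩
  · exact ⟨l, List.Perm.refl _, hch, hv⟩

theorem IsMinCover.not_adj_ends_of_odd_path (h : IsMinCover G 𝓕) {u v : V}
    (hu : IsPathEnd (factor 𝓕) u) (hv : IsPathEnd (factor 𝓕) v) (huv : u ≠ v)
    (hr : (factor 𝓕).Reachable u v)
    (hodd : Odd (((factor 𝓕).connectedComponentMk u).supp.ncard)) : ¬ G.Adj u v := by
  intro hadj
  obtain ⟨l, hl, hul, hue⟩ := h.1.exists_path_of_isPathEnd hu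
  obtain ⟨m, hm, hvm, hve⟩ := h.1.exists_path_of_isPathEnd hv
  have hvl : v ∈ l := (h.1.reachable_iff hl hul).1 hr
  obtain rfl : l = m := Piece.path.inj (h.1.eq_of_mem hl hm hvl hvm)
  rw [h.1.ncard_supp hl hul] at hodd
  refine h.not_endsAdj_of_odd hl ⟨hodd, ?_⟩
  rcases hue with hue | hue <;> rcases hve with hve | hve
  · exact absurd (Option.mem_unique hue hve) huv
  · exact ⟨u, hue, v, hve, hadj⟩
  · exact ⟨v, hve, u, hue, hadj.symm⟩
  · exact absurd (Option.mem_unique hue hve) huv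

theorem IsMinCover.not_adj_ends_of_ne (h : IsMinCover G 𝓕) {u v : V}
    (hu : IsPathEnd (factor 𝓕) u) (hv : IsPathEnd (factor 𝓕) v)
    (hr : ¬ (factor 𝓕).Reachable u v) : ¬ G.Adj u v := by
  obtain ⟨l, hl, hul, hue⟩ := h.1.exists_path_of_isPathEnd hu
  obtain ⟨m, hm, hvm, hve⟩ := h.1.exists_path_of_isPathEnd hv
  have hne : path l ≠ path m := by
    intro heq
    obtain rfl := Piece.path.inj heq
    exact hr ((h.1.reachable_iff hl hul).2 hvm)
  obtain ⟨l', hlp, hlc, hul'⟩ := h.1.exists_perm_getLast hl hue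
  obtain ⟨m', hmp, hmc, hvm'⟩ := h.1.exists_perm_getLast hm hve
  exact h.not_adj_of_paths hl hm hne hlp ((List.reverse_perm m').trans hmp) hlc
    (isChain_adj_reverse.2 hmc) hul' (by simpa using hvm')

theorem IsMinCover.adj_of_odd_cycle (h : IsMinCover G 𝓕) (hG : IsCubic G) {v u w : V}
    (hv : InOddCycle (factor 𝓕) v) (hvu : (factor 𝓕).Reachable v u)
    (hvw : (factor 𝓕).Reachable v w) (huw : G.Adj u w) : (factor 𝓕).Adj u w := by
  obtain ⟨l, hl, hodd, hvl⟩ := h.1.exists_cycle_of_inOddCycle hv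
  have hul : u ∈ l := (h.1.reachable_iff hl hvl).1 hvu
  have hwl : w ∈ l := (h.1.reachable_iff hl hvl).1 hvw
  obtain ⟨t, ht⟩ := exists_isRotated_cons hul
  have hwt : w ∈ t := (List.mem_cons.1 (ht.mem_iff.1 hwl)).resolve_left huw.ne'
  rw [← SimpleGraph.mem_neighborSet, h.1.neighborSet_cycle hl ht]
  obtain ⟨A, B, rfl⟩ := List.append_of_mem hwt
  by_cases hA : A = []
  · subst hA
    exact Or.inl (by simp)
  by_cases hB : B = []
  · subst hB
    exact Or.inr (by simp)
  exact absurd huw (h.not_chord hG hl hodd ht hA hB)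

theorem IsMinCover.internal_of_adj_odd_cycle (h : IsMinCover G 𝓕) (hG : IsCubic G) {v x : V}
    (hv : InOddCycle (factor 𝓕) v) (hvx : G.Adj v x) (hr : ¬ (factor 𝓕).Reachable v x) :
    InOddPath (factor 𝓕) x ∧ ((factor 𝓕).neighborSet x).ncard = 2 := by
  obtain ⟨l, hl, hodd, hvl⟩ := h.1.exists_cycle_of_inOddCycle hv
  have hxl : x ∉ l := fun hxl => hr ((h.1.reachable_iff hl hvl).2 hxl)
  obtain ⟨π, hπ, hxπ⟩ := h.1.exists_mem x
  cases π with
  | cycle m =>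
    refine absurd hvx (h.not_adj_of_cycles hG hl hodd hπ ?_ hvl hxπ)
    intro heq
    exact hxl (Piece.cycle.inj heq ▸ hxπ)
  | path P =>
    obtain ⟨u, hu, hu1⟩ := h.1.exists_end_of_path hπ
    have hreach := (h.1.reachable_iff hπ hxπ).2 hu
    obtain ⟨A, B, rfl⟩ := List.append_of_mem (show x ∈ P from hxπ)
    obtain ⟨hA, hB⟩ := h.odd_parts_of_adj_cycle hG hl hodd hπ hvl hvx.symm
    refine ⟨⟨⟨u, hreach, hu1⟩, ?_⟩, ?_⟩
    · rw [h.1.ncard_supp hπ hxπ]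
      simp only [verts, List.length_append, List.length_cons]
      rw [Nat.odd_iff] at *
      omega
    · rw [h.1.ncard_neighborSet_path hπ, if_neg]
      rintro (rfl | rfl)
      · simp at hA
      · simp at hB

theorem IsMinCover.eq_of_attached (h : IsMinCover G 𝓕) (hG : IsCubic G) {p u u' w w' : V}
    (hp : InOddPath (factor 𝓕) p) (hpu : (factor 𝓕).Reachable p u)
    (hpu' : (factor 𝓕).Reachable p u') (hw : InOddCycle (factor 𝓕) w)
    (hw' : InOddCycle (factor 𝓕) w') (huw : G.Adj u w) (huw' : G.Adj u' w') : w = w' := by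
  obtain ⟨P, hP, hpP⟩ := h.1.exists_path_of_inOddPath hp
  obtain ⟨l, hl, hodd, hwl⟩ := h.1.exists_cycle_of_inOddCycle hw
  obtain ⟨m, hm, hmodd, hwm⟩ := h.1.exists_cycle_of_inOddCycle hw'
  have huP : u ∈ P := (h.1.reachable_iff hP hpP).1 hpu
  have huP' : u' ∈ P := (h.1.reachable_iff hP hpP).1 hpu'
  obtain ⟨A, B, rfl⟩ := List.append_of_mem huP
  rcases List.mem_append.1 huP' with hA | hB
  · obtain ⟨C, D, rfl⟩ := List.append_of_mem hA
    exact (h.not_two_attached hG hm hmodd hl hodd (A := C) (M := D) (B := B)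
      (by simpa using hP) hwm huw' hwl huw).elim
  rcases List.mem_cons.1 hB with rfl | hB
  swap
  · obtain ⟨C, D, rfl⟩ := List.append_of_mem hB
    exact (h.not_two_attached hG hl hodd hm hmodd hP hwl huw hwm huw').elim
  obtain ⟨hA, hB⟩ := h.odd_parts_of_adj_cycle hG hl hodd hP hwl huw
  by_contra hne
  rcases A.eq_nil_or_concat with rfl | ⟨A, a, rfl⟩
  · simp at hA
  obtain ⟨b, B, rfl⟩ : ∃ b B', B = b :: B' := by
    refine List.exists_cons_of_ne_nil ?_
    rintro rfl
    simp at hB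
  have hch := (h.1.1 _ hP).1
  have hau : G.Adj a u' := by
    simpa using isChain_of_isSegment hch (l₁ := [a, u']) ⟨A, b :: B, by simp⟩
  have hub : G.Adj u' b := by
    simpa using isChain_of_isSegment hch (l₁ := [u', b]) ⟨A ++ [a], B, by simp⟩
  have hnotin : ∀ {x y : V} {l : List V}, cycle l ∈ 𝓕 → y ∈ l →
      x ∈ A.concat a ++ u' :: b :: B → x ≠ y := by
    rintro x y l hl hy hx rfl
    cases h.1.eq_of_mem hP hl hx hy
  have hab : a ≠ b := by
    have hnd := h.1.nodup hP
    rintro rfl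
    simp [verts, List.nodup_append] at hnd
  exact hG.not_four_adj hau.symm hub huw huw' hab
    (hnotin hl hwl (by simp)) (hnotin hm hwm (by simp)) (hnotin hl hwl (by simp))
    (hnotin hm hwm (by simp)) hne

end Factor

/-- every cubic graph contains a spanning factor whose components are
paths (on at least two vertices) or cycles, satisfying conditions (1)–(5). -/
theorem stmt18 [Fintype V] (G : SimpleGraph V) (hG : IsCubic G) :
    ∃ F : SimpleGraph V, F ≤ G ∧
      -- every component is a path on ≥ 2 vertices or a cycle:
      (∀ v : V, (F.neighborSet v).ncard = 1 ∨ (F.neighborSet v).ncard = 2) ∧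
      -- (1) the two endvertices of an odd path are non-adjacent in G:
      (∀ u v : V, IsPathEnd F u → IsPathEnd F v → u ≠ v → F.Reachable u v →
        Odd ((F.connectedComponentMk u).supp.ncard) → ¬ G.Adj u v) ∧
      -- (2) endvertices of two different paths are non-adjacent in G:
      (∀ u v : V, IsPathEnd F u → IsPathEnd F v → ¬ F.Reachable u v → ¬ G.Adj u v) ∧
      -- (3) every odd cycle of F is an induced (chordless) cycle of G:
      (∀ v u w : V, InOddCycle F v → F.Reachable v u → F.Reachable v w →
        G.Adj u w → F.Adj u w) ∧
      -- (4) a G-neighbour outside an odd cycle is an internal vertex of an odd path: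
      (∀ v x : V, InOddCycle F v → G.Adj v x → ¬ F.Reachable v x →
        InOddPath F x ∧ (F.neighborSet x).ncard = 2) ∧
      -- (5) an odd path is connected to at most one vertex of at most one odd cycle:
      (∀ p u u' w w' : V, InOddPath F p → F.Reachable p u → F.Reachable p u' →
        InOddCycle F w → InOddCycle F w' → G.Adj u w → G.Adj u' w' → w = w') := by
  obtain ⟨𝓕, h⟩ := hG.exists_isMinCover
  refine ⟨factor 𝓕, h.1.factor_le, fun v => ?_,
    fun _ _ hu hv huv hr hodd => h.not_adj_ends_of_odd_path hu hv huv hr hodd,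
    fun _ _ hu hv hr => h.not_adj_ends_of_ne hu hv hr,
    fun _ _ _ hv hu hw huw => h.adj_of_odd_cycle hG hv hu hw huw,
    fun _ _ hv hvx hr => h.internal_of_adj_odd_cycle hG hv hvx hr,
    fun _ _ _ _ _ hp hu hu' hw hw' huw huw' => h.eq_of_attached hG hp hu hu' hw hw' huw huw'⟩
  obtain ⟨π, hπ, hvπ⟩ := h.1.exists_mem v
  cases π with
  | cycle l => exact Or.inr (h.1.ncard_neighborSet_cycle hπ hvπ)
  | path l =>
    obtain ⟨s, t, rfl⟩ := List.append_of_mem (show v ∈ l from hvπ)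
    rw [h.1.ncard_neighborSet_path hπ]
    split_ifs <;> simp

end BEF
end

section
/- Let k≥3 be an integer and let (V₁,V₂) be a k-weak bisection of a cubic graph G=(V,E). Then for every subset A of V: (k−2)·d(A) + (k−3)·|A| ≥ (2k−3)·Δ(A). -/
open Finset
open scoped Classical

namespace BEF

variable {V : Type*}

theorem sum_degree_of_isAcyclic {W : Type*} [Fintype W] {H : SimpleGraph W}
    (hH : H.IsAcyclic) {m : ℕ} (hm : ∀ c : H.ConnectedComponent, c.supp.ncard ≤ m) :
    m * ∑ v, H.degree v + 2 * Fintype.card W ≤ 2 * m * Fintype.card W := by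
  have fiber (f : W → ℕ) :
      ∑ v, f v = ∑ c : H.ConnectedComponent, ∑ v : c.supp, f v := by
    rw [← Finset.sum_fiberwise univ H.connectedComponentMk f]
    refine Finset.sum_congr rfl fun c _ ↦ ?_
    exact Finset.sum_subtype _ (by simp) f
  have key (c : H.ConnectedComponent) :
      m * ∑ v : c.supp, H.degree v + 2 * Fintype.card c.supp ≤ 2 * m * Fintype.card c.supp := by
    have hdeg : ∑ v : c.supp, H.degree v = ∑ v, (H.induce c.supp).degree v := by
      refine Finset.sum_congr rfl fun v _ ↦ Eq.symm ?_
      convert SimpleGraph.degree_induce_of_neighborSet_subset (v := v) ?_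
      exact fun w hw ↦ c.mem_supp_of_adj_mem_supp v.2 hw
    have htree : (H.induce c.supp).IsTree := ⟨c.connected_toSimpleGraph, hH.induce _⟩
    have hcard := htree.card_edgeFinset
    have hle := hm c
    rw [← Nat.card_coe_set_eq, Nat.card_eq_fintype_card] at hle
    rw [hdeg, SimpleGraph.sum_degrees_eq_twice_card_edges]
    rw [← hcard] at hle ⊢
    nlinarith
  have hW : Fintype.card W = ∑ c : H.ConnectedComponent, Fintype.card c.supp := by
    simpa using fiber fun _ ↦ 1
  rw [fiber, hW, Finset.mul_sum, Finset.mul_sum, Finset.mul_sum, ← Finset.sum_add_distrib]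
  exact Finset.sum_le_sum fun c _ ↦ key c

theorem WeakSide.mono [Finite V] {G : SimpleGraph V} {k : ℕ} {S X : Set V}
    (h : WeakSide G k S) (hX : X ⊆ S) : WeakSide G k X := by
  refine ⟨h.1.embedding (G.induceHomOfLE hX), fun c ↦ ?_⟩
  let φ := (G.induceHomOfLE hX).toHom
  refine le_trans ?_ (h.2 (c.map φ))
  refine Set.ncard_le_ncard_of_injOn φ (fun v hv ↦ ?_)
    (G.induceHomOfLE hX).injective.injOn (Set.toFinite _)
  rw [SimpleGraph.ConnectedComponent.mem_supp_iff] at hv ⊢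
  rw [← hv, SimpleGraph.ConnectedComponent.map_mk]

theorem card_interedges_eq_sum (G : SimpleGraph V) (s t : Finset V) :
    #(G.interedges s t) = ∑ v ∈ s, #{w ∈ t | G.Adj v w} := by
  simp only [SimpleGraph.interedges_def, Finset.card_filter, Finset.sum_product]

theorem IsCubic.card_interedges_univ [Fintype V] {G : SimpleGraph V} (hG : IsCubic G)
    (s : Finset V) : #(G.interedges s univ) = 3 * #s := by
  have h (v : V) : #{w | G.Adj v w} = 3 := by
    rw [← hG v, ← Set.ncard_coe_finset]
    congr 1
    ext w
    simp
  simp [card_interedges_eq_sum, h, mul_comm]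

theorem sum_degree_induce [Fintype V] (G : SimpleGraph V) (s : Finset V) :
    ∑ v, (G.induce (s : Set V)).degree v = #(G.interedges s s) := by
  rw [card_interedges_eq_sum, ← Finset.sum_coe_sort s]
  refine Finset.sum_congr rfl fun v _ ↦ ?_
  rw [← SimpleGraph.card_neighborFinset_eq_degree]
  refine Finset.card_bij (fun w _ ↦ w) ?_ ?_ ?_
  · intro w hw
    simpa using hw
  · intro a _ b _ h
    exact Subtype.ext h
  · intro w hw
    rw [Finset.mem_filter] at hw
    exact ⟨⟨w, hw.1⟩, by simpa using hw.2, rfl⟩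

theorem card_interedges_le_cutCard [Fintype V] (G : SimpleGraph V) {A : Set V} {s t : Finset V}
    (hs : ∀ v ∈ s, v ∈ A) (ht : ∀ v ∈ t, v ∉ A) : #(G.interedges s t) ≤ cutCard G A := by
  rw [← Set.ncard_coe_finset, cutCard]
  refine Set.ncard_le_ncard_of_injOn (fun e ↦ s(e.1, e.2)) ?_ ?_ (Set.toFinite _)
  · rintro ⟨u, v⟩ h
    rw [Finset.mem_coe, SimpleGraph.mk_mem_interedges_iff] at h
    exact ⟨h.2.2, u, hs u h.1, v, ht v h.2.1, rfl⟩
  · rintro ⟨u, v⟩ h ⟨u', v'⟩ h' heq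
    rw [Finset.mem_coe, SimpleGraph.mk_mem_interedges_iff] at h h'
    rcases Sym2.eq_iff.1 heq with ⟨h₁, h₂⟩ | ⟨h₁, -⟩
    · exact Prod.ext h₁ h₂
    · exact absurd (hs u h.1) ((show u = v' from h₁) ▸ ht v' h'.2.1)

theorem WeakSide.cut_bound [Fintype V] {G : SimpleGraph V} (hG : IsCubic G) {k : ℕ}
    {S T : Set V} (hS : WeakSide G k S) (hST : S ∪ T = Set.univ) (A : Set V) :
    (k - 2 + 2) * (S ∩ A).ncard ≤ (k - 2) * (cutCard G A + 3 * (T ∩ A).ncard) := by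
  set X := (S ∩ A).toFinset with hX
  set Y := (T ∩ A).toFinset with hY
  rw [Set.ncard_eq_toFinset_card', Set.ncard_eq_toFinset_card', ← hX, ← hY]
  have hw : WeakSide G k (X : Set V) := hS.mono (by simp [hX])
  have hforest : (k - 2) * #(G.interedges X X) + 2 * #X ≤ 2 * (k - 2) * #X := by
    rw [← sum_degree_induce, ← Fintype.card_coe X]
    convert sum_degree_of_isAcyclic hw.1 hw.2 <;> exact Finset.mem_coe.symm
  have hsub : G.interedges X univ ⊆
      G.interedges X X ∪ G.interedges X Y ∪ G.interedges X Aᶜ.toFinset := by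
    rintro ⟨u, v⟩ h
    have hv : v ∈ S ∪ T := hST ▸ Set.mem_univ v
    simp only [Finset.mem_union, SimpleGraph.mk_mem_interedges_iff, hX, hY, Set.mem_toFinset,
      Set.mem_inter_iff, Set.mem_compl_iff, Finset.mem_univ, true_and, Set.mem_union] at h hv ⊢
    tauto
  have hXY : #(G.interedges X Y) ≤ 3 * #Y := by
    have := G.symm
    rw [SimpleGraph.interedges, Rel.card_interedges_comm, ← hG.card_interedges_univ Y]
    exact Finset.card_le_card (G.interedges_mono subset_rfl (Finset.subset_univ X))
  have hXA : #(G.interedges X Aᶜ.toFinset) ≤ cutCard G A :=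
    card_interedges_le_cutCard G (by simp [hX]) (by simp)
  have hcount := (Finset.card_le_card hsub).trans
    ((Finset.card_union_le _ _).trans (add_le_add_left (Finset.card_union_le _ _) _))
  rw [hG.card_interedges_univ] at hcount
  have hle : 3 * #X ≤ #(G.interedges X X) + (cutCard G A + 3 * #Y) := by omega
  have := Nat.mul_le_mul_left (k - 2) hle
  linarith

/-- the cut inequality satisfied by every `k`-weak bisection. -/
theorem stmt19 [Fintype V] (G : SimpleGraph V) (hG : IsCubic G)
    (k : ℕ) (hk : 3 ≤ k) (V₁ V₂ : Set V) (hw : KWeak G k V₁ V₂) :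
    ∀ A : Set V, (2 * (k : ℤ) - 3) * disc V₁ V₂ A ≤
      ((k : ℤ) - 2) * (cutCard G A : ℤ) + ((k : ℤ) - 3) * (A.ncard : ℤ) := by
  intro A
  obtain ⟨⟨hd, hU, -⟩, h₁, h₂⟩ := hw
  have b₁ := h₁.cut_bound hG hU A
  have b₂ := h₂.cut_bound hG (Set.union_comm V₁ V₂ ▸ hU) A
  have hA : A.ncard = (V₁ ∩ A).ncard + (V₂ ∩ A).ncard := by
    rw [← Set.ncard_union_eq (hd.mono Set.inter_subset_left Set.inter_subset_left)
      (Set.toFinite _) (Set.toFinite _), ← Set.union_inter_distrib_right, hU, Set.univ_inter]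
  obtain ⟨m, rfl⟩ : ∃ m, k = m + 2 := ⟨k - 2, by omega⟩
  rw [Nat.add_sub_cancel] at b₁ b₂
  zify at b₁ b₂
  rw [disc, hA]
  push_cast
  rcases abs_cases (((V₂ ∩ A).ncard : ℤ) - ((V₁ ∩ A).ncard : ℤ)) with ⟨h, -⟩ | ⟨h, -⟩ <;>
    rw [h] <;> linarith

end BEF
end
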